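/- arXiv:1205.5200 — 5 statements merged into one kernel-verified Lean document; each statement's English description precedes it below -/
import Mathlib

section
/- The dimension of the zero weight space of the little adjoint module equals the number of short simple roots: dim V_{θ_s}^0 = #Π_s. -/
open scoped RealInnerProductSpace

/-- The orthogonal reflection of a Euclidean space in the hyperplane orthogonal to `α`. -/
noncomputable def rrefl {E : Type} [NormedAddCommGroup E] [InnerProductSpace ℝ E]
    [FiniteDimensional ℝ E] (α : E) : E ≃ₗᵢ[ℝ] E :=
  Submodule.reflection ((ℝ ∙ α)ᗮ)

/-- The `χ`-weight space of the `L`-module `M` with respect to the subalgebra `H`: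
`{v : M | ∀ x ∈ H, x · v = χ(x) • v}`.  With `M := L` (adjoint action) and `χ = e μ` this is
the root space `𝔤^μ`. -/
def hwt {L : Type} [LieRing L] [LieAlgebra ℂ L] (H : LieSubalgebra ℂ L)
    (M : Type) [AddCommGroup M] [Module ℂ M] [LieRingModule L M] [LieModule ℂ L M]
    (χ : H → ℂ) : Submodule ℂ M where
  carrier := {v | ∀ x : H, ⁅(x : L), v⁆ = χ x • v}
  add_mem' := by
    intro a b ha hb x
    rw [lie_add, ha x, hb x, smul_add]
  zero_mem' := by
    intro x
    rw [lie_zero, smul_zero]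
  smul_mem' := by
    intro c v hv x
    rw [lie_smul, hv x, smul_comm]

/-- The action of `x ∈ L` on the module `M`, as a linear map `M →ₗ M`. -/
def adm (L : Type) [LieRing L] [LieAlgebra ℂ L]
    (M : Type) [AddCommGroup M] [Module ℂ M] [LieRingModule L M] [LieModule ℂ L M]
    (x : L) : M →ₗ[ℂ] M where
  toFun v := ⁅x, v⁆
  map_add' a b := lie_add x a b
  map_smul' c v := lie_smul c x v

/-- For `v ∈ M`, the linear map `L → M`, `y ↦ y · v`; its range is `𝔤·v` and its kernel is
the stabiliser of `v` in `L`. -/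
def actOn (L : Type) [LieRing L] [LieAlgebra ℂ L]
    (M : Type) [AddCommGroup M] [Module ℂ M] [LieRingModule L M] [LieModule ℂ L M]
    (v : M) : L →ₗ[ℂ] M where
  toFun y := ⁅y, v⁆
  map_add' a b := add_lie a b v
  map_smul' c y := smul_lie c y v

section part1
variable {L : Type} [LieRing L] [LieAlgebra ℂ L] {H : LieSubalgebra ℂ L}
  {M : Type} [AddCommGroup M] [Module ℂ M] [LieRingModule L M] [LieModule ℂ L M]

lemma mem_hwt {χ : H → ℂ} {v : M} : v ∈ hwt H M χ ↔ ∀ x : H, ⁅(x : L), v⁆ = χ x • v := Iff.rfl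

lemma hwt_lie {χ ψ : H → ℂ} {x : L} {v : M} (hx : x ∈ hwt H L χ) (hv : v ∈ hwt H M ψ) :
    ⁅x, v⁆ ∈ hwt H M (χ + ψ) := by
  intro y
  rw [leibniz_lie, hx y, hv y, smul_lie, lie_smul, ← add_smul, Pi.add_apply]

lemma hwt_indep [H.IsCartanSubalgebra] : iSupIndep (hwt H M) := by
  have h := LieModule.iSupIndep_genWeightSpace ℂ H M
  rw [← LieSubmodule.iSupIndep_toSubmodule] at h
  refine h.mono fun χ v hv => ?_
  exact LieModule.weightSpace_le_genWeightSpace M χ ((LieModule.mem_weightSpace χ v).2 hv)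

lemma hwt_le_root [H.IsCartanSubalgebra] {χ : H → ℂ} {x : L} (hx : x ∈ hwt H L χ) :
    x ∈ LieAlgebra.rootSpace H χ :=
  LieModule.weightSpace_le_genWeightSpace L χ ((LieModule.mem_weightSpace χ x).2 hx)

lemma sl2_f_inj [FiniteDimensional ℂ M] {h e f : L} (t : IsSl2Triple h e f) {v : M} {c : ℝ}
    (hv : ⁅h, v⁆ = (c : ℂ) • v) (hc : 0 < c) (hf : ⁅f, v⁆ = 0) : v = 0 := by
  by_contra hne
  have P : t.symm.HasPrimitiveVectorWith v (-(c : ℂ)) := ⟨hne, by rw [neg_lie, hv, neg_smul], hf⟩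
  obtain ⟨n, hn⟩ := P.exists_nat
  have : -c = (n : ℝ) := by exact_mod_cast hn
  have : (0 : ℝ) ≤ n := Nat.cast_nonneg n
  linarith

lemma sl2_e_inj [FiniteDimensional ℂ M] {h e f : L} (t : IsSl2Triple h e f) {v : M} {c : ℝ}
    (hv : ⁅h, v⁆ = (c : ℂ) • v) (hc : c < 0) (he : ⁅e, v⁆ = 0) : v = 0 := by
  refine sl2_f_inj t.symm (c := -c) ?_ (by linarith) he
  rw [neg_lie, hv]; push_cast; rw [neg_smul]

lemma sl2_zero [FiniteDimensional ℂ M] {h e f : L} (t : IsSl2Triple h e f) {v : M}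
    (hv : ⁅h, v⁆ = 0) (he : ⁅e, v⁆ = 0) : ⁅f, v⁆ = 0 := by
  by_cases hne : v = 0
  · simp [hne]
  have P : t.HasPrimitiveVectorWith v (0 : ℂ) := ⟨hne, by simp [hv], he⟩
  simpa using P.pow_toEnd_f_eq_zero_of_eq_nat (n := 0) (by simp)

lemma lie_data {E : Type} [AddCommGroup E] (Δ : Set E) (h0 : (0 : E) ∉ Δ) [FiniteDimensional ℂ L]
    [LieAlgebra.IsSimple ℂ L] [H.IsCartanSubalgebra]
    (e : E → H → ℂ)
    (headd : ∀ a b : E, e (a + b) = e a + e b)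
    (heinj : Function.Injective e)
    (hroots1 : ∀ μ ∈ Δ, hwt H L (e μ) ≠ ⊥)
    (hroots2 : ∀ χ : H → ℂ, χ ≠ 0 → hwt H L χ ≠ ⊥ → ∃ μ ∈ Δ, χ = e μ) :
    (hwt H L (0 : H → ℂ) ≤ H.toSubmodule) ∧
    (H.toSubmodule ⊔ ⨆ μ ∈ Δ, hwt H L (e μ) = ⊤) ∧
    ∃ (hc : E → H) (ec fc : E → L), ∀ α ∈ Δ, IsSl2Triple (hc α : L) (ec α) (fc α) ∧
      ec α ∈ hwt H L (e α) ∧ fc α ∈ hwt H L (e (-α)) ∧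
      ∀ β ∈ Δ, ∃ n : ℤ, e β (hc α) = n ∧ β - n • α ∈ Δ := by
  classical
  have e0 : e 0 = 0 := by simpa using headd 0 0
  let eh : E →+ (H → ℂ) := ⟨⟨e, e0⟩, headd⟩
  have eneg : ∀ a, e (-a) = - e a := fun a => map_neg eh a
  have ene : ∀ a ∈ Δ, e a ≠ 0 := by
    intro a ha h
    rw [← e0] at h
    exact h0 (heinj h ▸ ha)
  have hz : hwt H L (0 : H → ℂ) ≤ H.toSubmodule := by
    intro x hx
    have := hwt_le_root hx
    have h2 := LieAlgebra.zeroRootSubalgebra_eq_of_is_cartan ℂ L H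
    have : x ∈ LieAlgebra.zeroRootSubalgebra ℂ L H := this
    rw [h2] at this
    exact this
  have hback : ∀ (χ : H → ℂ) (x : L), x ∈ LieAlgebra.rootSpace H χ → x ∈ hwt H L χ := by
    intro χ x hx y
    exact LieAlgebra.IsKilling.lie_eq_smul_of_mem_rootSpace hx y
  refine ⟨hz, ?_, ?_⟩
  · have h := LieModule.iSup_genWeightSpace_eq_top ℂ H L
    rw [← LieSubmodule.toSubmodule_inj, LieSubmodule.iSup_toSubmodule,
      LieSubmodule.top_toSubmodule] at h
    rw [eq_top_iff, ← h]
    refine iSup_le fun χ x hx => ?_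
    have hx' := hback χ x hx
    by_cases hχ : χ = 0
    · subst hχ
      exact Submodule.mem_sup_left (hz hx')
    by_cases hb : hwt H L χ = ⊥
    · rw [hb] at hx'
      rw [(Submodule.mem_bot ℂ).1 hx']
      exact zero_mem _
    obtain ⟨μ, hμ, rfl⟩ := hroots2 χ hχ hb
    exact Submodule.mem_sup_right (Submodule.mem_iSup_of_mem μ (Submodule.mem_iSup_of_mem hμ hx'))
  · have hw : ∀ α ∈ Δ, ∃ w : LieModule.Weight ℂ H L, (w : H → ℂ) = e α := by
      intro α hα
      refine ⟨⟨e α, fun hb => ?_⟩, rfl⟩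
      refine hroots1 α hα ((Submodule.eq_bot_iff _).2 fun x hx => ?_)
      have := hwt_le_root hx
      rw [LieAlgebra.rootSpace, hb] at this
      exact (LieSubmodule.mem_bot x).1 this
    have key : ∀ α ∈ Δ, ∃ (hc : H) (ec fc : L), IsSl2Triple (hc : L) ec fc ∧
      ec ∈ hwt H L (e α) ∧ fc ∈ hwt H L (e (-α)) ∧
      ∀ β ∈ Δ, ∃ n : ℤ, e β hc = n ∧ β - n • α ∈ Δ := by
      intro α hα
      obtain ⟨w, hwα⟩ := hw α hα
      have hnz : w.IsNonZero := by
        intro hh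
        exact ene α hα (hwα ▸ hh)
      obtain ⟨h, x, y, t, hx, hy⟩ := LieAlgebra.IsKilling.exists_isSl2Triple_of_weight_isNonZero hnz
      have hco := IsSl2Triple.h_eq_coroot hnz t hx hy
      refine ⟨LieAlgebra.IsKilling.coroot w, x, y, hco ▸ t, ?_, ?_, ?_⟩
      · rw [← hwα]; exact hback _ _ hx
      · rw [eneg, ← hwα]; exact hback _ _ hy
      · intro β hβ
        obtain ⟨u, hu⟩ := hw β hβ
        have hunz : u.IsNonZero := by
          intro hh
          exact ene β hβ (hu ▸ hh)
        refine ⟨_, hu ▸ LieAlgebra.IsKilling.apply_coroot_eq_cast w u, ?_⟩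
        set n : ℤ := (LieModule.chainBotCoeff w u - LieModule.chainTopCoeff w u : ℤ) with hn
        let r := LieAlgebra.IsKilling.reflectRoot w u
        have hr : (r : H → ℂ) = e (β - n • α) := by
          have : (r : H → ℂ) = u - u (LieAlgebra.IsKilling.coroot w) • w := rfl
          rw [this, LieAlgebra.IsKilling.apply_coroot_eq_cast w u, ← hn, hwα, hu]
          change _ = eh (β - n • α)
          rw [map_sub, map_zsmul, Int.cast_smul_eq_zsmul]
          rfl
        have hrz := LieAlgebra.IsKilling.reflectRoot_isNonZero w u hunz
        obtain ⟨z, hz1, hz2⟩ := r.exists_ne_zero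
        obtain ⟨μ, hμ, hμ2⟩ := hroots2 (r : H → ℂ) hrz (fun hb => hz2 (by
          have := hback _ _ hz1
          rw [hb] at this
          exact (Submodule.mem_bot ℂ).1 this))
        rw [hr] at hμ2
        rw [heinj hμ2]
        exact hμ
    choose! hc ec fc hh using key
    exact ⟨hc, ec, fc, hh⟩

end part1
section part2
lemma refl_unique {E : Type} [AddCommGroup E] [Module ℝ E] {Δ : Set E} (hfin : Δ.Finite)
    {α β : E} (hα : α ≠ 0) (hβ : β ∈ Δ) {n m : ℤ}
    (hn : ∀ j : ℤ, β + j • α ∈ Δ → β + (-n - j) • α ∈ Δ)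
    (hm : ∀ j : ℤ, β + j • α ∈ Δ → β + (-m - j) • α ∈ Δ) : n = m := by
  have hinj : Function.Injective (fun j : ℤ => β + j • α) := by
    intro i j h
    have h : i • α = j • α := add_left_cancel h
    have h2 : ((i : ℝ) - j) • α = 0 := by
      rw [sub_smul, Int.cast_smul_eq_zsmul, Int.cast_smul_eq_zsmul, h, sub_self]
    rcases smul_eq_zero.1 h2 with h3 | h3
    · exact_mod_cast sub_eq_zero.1 h3
    · exact absurd h3 hα
  have hf : {j : ℤ | β + j • α ∈ Δ}.Finite := hfin.preimage hinj.injOn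
  set S := hf.toFinset with hS
  have mem : ∀ j, j ∈ S ↔ β + j • α ∈ Δ := fun j => by simp [hS]
  have key : ∀ n : ℤ, (∀ j : ℤ, β + j • α ∈ Δ → β + (-n - j) • α ∈ Δ) →
      2 * ∑ j ∈ S, j = - (S.card * n) := by
    intro n hn
    have h1 : ∑ j ∈ S, j = ∑ j ∈ S, (-n - j) := by
      refine Finset.sum_nbij' (fun j => -n - j) (fun j => -n - j) ?_ ?_ ?_ ?_ ?_
      · intro j hj; rw [mem] at *; exact hn j hj
      · intro j hj; rw [mem] at *; exact hn j hj
      · intro j _; ring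
      · intro j _; ring
      · intro j _; ring
    rw [Finset.sum_sub_distrib, Finset.sum_const, nsmul_eq_mul] at h1
    linarith
  have h1 := key n hn
  have h2 := key m hm
  have hc : (S.card : ℤ) ≠ 0 := by
    have : (0 : ℤ) ∈ S := by rw [mem]; simpa using hβ
    have := Finset.card_pos.2 ⟨_, this⟩
    omega
  have : (S.card : ℤ) * n = S.card * m := by linarith
  exact mul_left_cancel₀ hc this

lemma rrefl_eq {E : Type} [NormedAddCommGroup E] [InnerProductSpace ℝ E]
    [FiniteDimensional ℝ E] (α β : E) : rrefl α β = β - (2 * ⟪β, α⟫ / ⟪α, α⟫) • α := by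
  rw [rrefl, Submodule.reflection_orthogonal_apply, Submodule.reflection_singleton_apply,
    real_inner_self_eq_norm_sq, real_inner_comm]
  simp only [RCLike.ofReal_real_eq_id, id]
  rw [neg_sub, two_nsmul, ← add_smul]
  congr 2
  ring
end part2
section part3

structure Ctx {E : Type} [NormedAddCommGroup E] [InnerProductSpace ℝ E] (Δ Δp Φ : Set E)
    {L : Type} [LieRing L] [LieAlgebra ℂ L] (H : LieSubalgebra ℂ L) (e : E → H → ℂ)
    (hc : E → H) (ec fc : E → L) (b : Module.Basis Φ ℝ E) : Prop where
  fin : Δ.Finite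
  h0 : (0 : E) ∉ Δ
  refl : ∀ α ∈ Δ, ∀ β ∈ Δ, β - (2 * ⟪β, α⟫ / ⟪α, α⟫) • α ∈ Δ
  crys : ∀ α ∈ Δ, ∀ β ∈ Δ, ∃ n : ℤ, 2 * ⟪β, α⟫ / ⟪α, α⟫ = (n : ℝ)
  red : ∀ α ∈ Δ, ∀ t : ℝ, t • α ∈ Δ → t = 1 ∨ t = -1
  pΔ : Δp ⊆ Δ
  pm : ∀ α ∈ Δ, α ∈ Δp ∨ -α ∈ Δp
  neg : ∀ α ∈ Δ, -α ∈ Δ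
  Φp : Φ ⊆ Δp
  pos : ∀ γ ∈ Δp, γ ∈ AddSubmonoid.closure Φ
  b_apply : ∀ a, b a = a
  add : ∀ a b : E, e (a + b) = e a + e b
  inj : Function.Injective e
  root : ∀ μ : E, μ ≠ 0 → hwt H L (e μ) ≠ ⊥ → μ ∈ Δ
  zero : hwt H L (0 : H → ℂ) ≤ H.toSubmodule
  top : H.toSubmodule ⊔ ⨆ μ ∈ Δ, hwt H L (e μ) = ⊤
  tri : ∀ α ∈ Δ, IsSl2Triple (hc α : L) (ec α) (fc α)
  ecm : ∀ α ∈ Δ, ec α ∈ hwt H L (e α)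
  fcm : ∀ α ∈ Δ, fc α ∈ hwt H L (e (-α))
  comp : ∀ α ∈ Δ, ∀ β ∈ Δ, e β (hc α) = ((2 * ⟪β, α⟫ / ⟪α, α⟫ : ℝ) : ℂ)

namespace Ctx
variable {E : Type} [NormedAddCommGroup E] [InnerProductSpace ℝ E] {Δ Δp Φ : Set E}
    {L : Type} [LieRing L] [LieAlgebra ℂ L] {H : LieSubalgebra ℂ L} {e : E → H → ℂ}
    {hc : E → H} {ec fc : E → L} {b : Module.Basis Φ ℝ E}
    (C : Ctx Δ Δp Φ H e hc ec fc b)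
  {M : Type} [AddCommGroup M] [Module ℂ M] [LieRingModule L M] [LieModule ℂ L M]

include C

lemma e_zero : e 0 = 0 := by simpa using C.add 0 0
lemma e_neg (a : E) : e (-a) = - e a := by
  rw [eq_neg_iff_add_eq_zero, ← C.add, neg_add_cancel, C.e_zero]
lemma e_sub (a b : E) : e (a - b) = e a - e b := by
  rw [sub_eq_add_neg, C.add, C.e_neg, sub_eq_add_neg]
lemma ΦΔ {a : E} (h : a ∈ Φ) : a ∈ Δ := C.pΔ (C.Φp h)
lemma ne0 {a : E} (h : a ∈ Δ) : a ≠ 0 := fun h' => C.h0 (h' ▸ h)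
lemma ip {a : E} (h : a ∈ Δ) : 0 < ⟪a, a⟫ := real_inner_self_pos.2 (C.ne0 h)

lemma repr_nn {x : E} (hx : x ∈ AddSubmonoid.closure Φ) (a : Φ) : 0 ≤ b.repr x a := by
  classical
  induction hx using AddSubmonoid.closure_induction with
  | mem x hx =>
    have : x = b ⟨x, hx⟩ := by rw [C.b_apply]
    rw [this, Module.Basis.repr_self, Finsupp.single_apply]
    split_ifs <;> norm_num
  | zero => simp
  | add x y _ _ hx hy => rw [map_add, Finsupp.add_apply]; exact add_nonneg hx hy

lemma cone_zero {x : E} (hx : x ∈ AddSubmonoid.closure Φ) (hx' : -x ∈ AddSubmonoid.closure Φ) :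
    x = 0 := by
  apply b.repr.injective
  ext a
  have h1 := C.repr_nn hx a
  have h2 := C.repr_nn hx' a
  rw [map_neg, Finsupp.neg_apply] at h2
  rw [map_zero, Finsupp.zero_apply]
  linarith

lemma add_ne {x y : E} (hx : x ∈ AddSubmonoid.closure Φ) (hy : y ∈ AddSubmonoid.closure Φ)
    (h : y ≠ 0) : x + y ≠ 0 := by
  intro hxy
  refine h (C.cone_zero hy ?_)
  rwa [← eq_neg_of_add_eq_zero_left hxy]

lemma inner_cone [Fintype Φ] {x l : E} (hx : ∀ a, 0 ≤ b.repr x a) (hl : ∀ a ∈ Φ, 0 ≤ ⟪a, l⟫) :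
    0 ≤ ⟪x, l⟫ := by
  rw [← b.sum_repr x, sum_inner]
  refine Finset.sum_nonneg fun a _ => ?_
  rw [real_inner_smul_left, C.b_apply]
  exact mul_nonneg (hx a) (hl a a.2)

lemma hw_top [Nontrivial M] (hMsimple : ∀ N : LieSubmodule ℂ L M, N = ⊥ ∨ N = ⊤)
    {v : M} {μ : E} (hv0 : v ≠ 0) (hv : v ∈ hwt H M (e μ))
    (hk : ∀ γ ∈ Δp, ∀ x ∈ hwt H L (e γ), ⁅x, v⁆ = 0) :
    (ℂ ∙ v) ⊔ ⨆ β ∈ {β | β ∈ AddSubmonoid.closure Φ ∧ β ≠ 0}, hwt H M (e (μ - β)) = ⊤ := by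
  set U := (ℂ ∙ v) ⊔ ⨆ β ∈ {β | β ∈ AddSubmonoid.closure Φ ∧ β ≠ 0}, hwt H M (e (μ - β)) with hU
  let nm : Submodule ℂ L := ⨆ γ ∈ Δp, hwt H L (e (-γ))
  let bp : Submodule ℂ L := H.toSubmodule ⊔ ⨆ γ ∈ Δp, hwt H L (e γ)
  have htop : nm ⊔ bp = ⊤ := by
    rw [eq_top_iff, ← C.top]
    refine sup_le (le_sup_of_le_right le_sup_left) (iSup₂_le fun γ hγ => ?_)
    rcases C.pm γ hγ with h | h
    · exact le_sup_of_le_right (le_sup_of_le_right (le_iSup₂_of_le γ h le_rfl))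
    · refine le_sup_of_le_left (le_iSup₂_of_le (-γ) h ?_)
      rw [neg_neg]
  let F : Set (Submodule ℂ M) := {P | v ∈ P ∧ ∀ y ∈ nm, ∀ w ∈ P, ⁅y, w⁆ ∈ P}
  let N : Submodule ℂ M := sInf F
  have hNv : v ∈ N := Submodule.mem_sInf.2 fun P hP => hP.1
  have hNy : ∀ y ∈ nm, ∀ w ∈ N, ⁅y, w⁆ ∈ N := fun y hy w hw =>
    Submodule.mem_sInf.2 fun P hP => hP.2 y hy w (Submodule.mem_sInf.1 hw P hP)
  have hbv : ∀ x ∈ bp, ⁅x, v⁆ ∈ Submodule.span ℂ {v} := by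
    have : bp ≤ (Submodule.span ℂ {v}).comap (actOn L M v) := by
      refine sup_le (fun x hx => ?_) (iSup₂_le fun γ hγ x hx => ?_)
      · change ⁅x, v⁆ ∈ Submodule.span ℂ {v}
        have := hv ⟨x, hx⟩
        change ⁅x, v⁆ = _ at this
        rw [this]
        exact Submodule.smul_mem _ _ (Submodule.mem_span_singleton_self v)
      · change ⁅x, v⁆ ∈ Submodule.span ℂ {v}
        rw [hk γ hγ x hx]
        exact zero_mem _
    exact fun x hx => this hx
  let P : Submodule ℂ M :=
    { carrier := {w | w ∈ N ∧ ∀ x ∈ bp, ⁅x, w⁆ ∈ N}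
      add_mem' := fun {u w} hu hw => ⟨add_mem hu.1 hw.1, fun x hx => by
        rw [lie_add]; exact add_mem (hu.2 x hx) (hw.2 x hx)⟩
      zero_mem' := ⟨zero_mem _, fun x _ => by rw [lie_zero]; exact zero_mem _⟩
      smul_mem' := fun c w hw => ⟨Submodule.smul_mem _ _ hw.1, fun x hx => by
        rw [lie_smul]; exact Submodule.smul_mem _ _ (hw.2 x hx)⟩ }
  have hPF : P ∈ F := by
    refine ⟨⟨hNv, fun x hx => ?_⟩, fun y hy w hw => ⟨hNy y hy w hw.1, fun x hx => ?_⟩⟩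
    · exact (Submodule.span_singleton_le_iff_mem v N).2 hNv (hbv x hx)
    · rw [leibniz_lie]
      refine add_mem ?_ (hNy y hy _ (hw.2 x hx))
      have : ⁅x, y⁆ ∈ nm ⊔ bp := htop ▸ Submodule.mem_top
      obtain ⟨y', hy', x', hx', h⟩ := Submodule.mem_sup.1 this
      rw [← h, add_lie]
      exact add_mem (hNy y' hy' w hw.1) (hw.2 x' hx')
  have hNP : N ≤ P := sInf_le hPF
  let N' : LieSubmodule ℂ L M :=
    { N with
      lie_mem := by
        intro x w hw
        have : x ∈ nm ⊔ bp := htop ▸ Submodule.mem_top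
        obtain ⟨y', hy', x', hx', h⟩ := Submodule.mem_sup.1 this
        change ⁅x, w⁆ ∈ N
        rw [← h, add_lie]
        exact add_mem (hNy y' hy' w hw) ((hNP hw).2 x' hx') }
  have hN' : N' = ⊤ := by
    refine (hMsimple N').resolve_left fun hb => hv0 ?_
    have : v ∈ N' := hNv
    rw [hb] at this
    exact (LieSubmodule.mem_bot v).1 this
  have hNtop : N = ⊤ := by
    rw [eq_top_iff]
    intro w _
    have : w ∈ N' := hN' ▸ LieSubmodule.mem_top w
    exact this
  have hUF : U ∈ F := by
    refine ⟨Submodule.mem_sup_left (Submodule.mem_span_singleton_self v), ?_⟩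
    have h1 : ∀ γ ∈ Δp, ∀ y ∈ hwt H L (e (-γ)), U ≤ U.comap (adm L M y) := by
      intro γ hγ y hy
      refine sup_le ?_ (iSup₂_le fun β hβ w hw => ?_)
      · rw [Submodule.span_singleton_le_iff_mem]
        change ⁅y, v⁆ ∈ U
        have := hwt_lie hy hv
        rw [← C.add, neg_add_eq_sub] at this
        exact Submodule.mem_sup_right (Submodule.mem_iSup_of_mem γ
          (Submodule.mem_iSup_of_mem ⟨C.pos γ hγ, C.ne0 (C.pΔ hγ)⟩ this))
      · change ⁅y, w⁆ ∈ U
        have := hwt_lie hy hw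
        rw [← C.add, neg_add_eq_sub, sub_sub] at this
        exact Submodule.mem_sup_right (Submodule.mem_iSup_of_mem (β + γ)
          (Submodule.mem_iSup_of_mem ⟨add_mem hβ.1 (C.pos γ hγ),
            C.add_ne hβ.1 (C.pos γ hγ) (C.ne0 (C.pΔ hγ))⟩ this))
    intro y hy w hw
    have : nm ≤ U.comap (actOn L M w) := iSup₂_le fun γ hγ y hy => h1 γ hγ y hy hw
    exact this hy
  rw [eq_top_iff, ← hNtop]
  exact sInf_le hUF

lemma hw_wt [H.IsCartanSubalgebra] [Nontrivial M]
    (hMsimple : ∀ N : LieSubmodule ℂ L M, N = ⊥ ∨ N = ⊤)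
    {v : M} {μ : E} (hv0 : v ≠ 0) (hv : v ∈ hwt H M (e μ))
    (hk : ∀ γ ∈ Δp, ∀ x ∈ hwt H L (e γ), ⁅x, v⁆ = 0) (χ : H → ℂ) (hχ : hwt H M χ ≠ ⊥) :
    ∃ β ∈ AddSubmonoid.closure Φ, χ = e (μ - β) := by
  by_contra! hcon
  have h := C.hw_top hMsimple hv0 hv hk
  have hd := (hwt_indep (H := H) (M := M)) χ
  apply hχ
  rw [← disjoint_top, ← h]
  refine hd.mono_right (sup_le ?_ (iSup₂_le fun β hβ => ?_))
  · rw [Submodule.span_singleton_le_iff_mem]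
    refine (le_iSup₂_of_le (f := fun j (_ : j ≠ χ) => hwt H M j) (e μ) ?_ le_rfl) hv
    have := hcon 0 (zero_mem _)
    rw [sub_zero] at this
    exact this.symm
  · exact le_iSup₂_of_le (f := fun j (_ : j ≠ χ) => hwt H M j) _ (hcon β hβ.1).symm le_rfl

lemma hw_one [H.IsCartanSubalgebra] [Nontrivial M]
    (hMsimple : ∀ N : LieSubmodule ℂ L M, N = ⊥ ∨ N = ⊤)
    {v : M} {μ : E} (hv0 : v ≠ 0) (hv : v ∈ hwt H M (e μ))
    (hk : ∀ γ ∈ Δp, ∀ x ∈ hwt H L (e γ), ⁅x, v⁆ = 0) :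
    Module.finrank ℂ (hwt H M (e μ)) = 1 := by
  have h := C.hw_top hMsimple hv0 hv hk
  have hd := (hwt_indep (H := H) (M := M)) (e μ)
  suffices hwt H M (e μ) = (ℂ ∙ v) by rw [this]; exact finrank_span_singleton hv0
  refine le_antisymm (fun w hw => ?_) ((Submodule.span_singleton_le_iff_mem _ _).2 hv)
  have hwt' : w ∈ (⊤ : Submodule ℂ M) := Submodule.mem_top
  rw [← h] at hwt'
  obtain ⟨x, hx, y, hy, rfl⟩ := Submodule.mem_sup.1 hwt'
  have hx' := (Submodule.span_singleton_le_iff_mem _ _).2 hv hx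
  have hy1 : y ∈ hwt H M (e μ) := by simpa using sub_mem hw hx'
  have hy2 : y ∈ ⨆ j, ⨆ (_ : j ≠ e μ), hwt H M j := by
    refine (iSup₂_le fun β hβ => ?_ :
      (⨆ β ∈ {β | β ∈ AddSubmonoid.closure Φ ∧ β ≠ 0}, hwt H M (e (μ - β))) ≤ _) hy
    refine le_iSup₂_of_le (f := fun j (_ : j ≠ e μ) => hwt H M j) _ (fun hh => hβ.2 ?_) le_rfl
    have := C.inj hh
    simpa using this
  have : y = 0 := Submodule.disjoint_def.1 hd y hy1 hy2
  rw [this, add_zero]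
  exact hx

lemma wt_fin [H.IsCartanSubalgebra] [FiniteDimensional ℂ M] :
    {μ : E | hwt H M (e μ) ≠ ⊥}.Finite := by
  have : {χ : H → ℂ | hwt H M χ ≠ ⊥}.Finite :=
    WellFoundedGT.finite_ne_bot_of_iSupIndep (hwt_indep (H := H) (M := M))
  exact this.preimage C.inj.injOn

lemma comp' {α : E} (hα : α ∈ Δ) {x : E} (hx : x ∈ AddSubgroup.closure Δ) :
    e x (hc α) = ((2 * ⟪x, α⟫ / ⟪α, α⟫ : ℝ) : ℂ) := by
  induction hx using AddSubgroup.closure_induction with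
  | mem x hx => exact C.comp α hα x hx
  | zero => simp [C.e_zero]
  | add x y _ _ hx hy =>
    rw [C.add, Pi.add_apply, hx, hy, inner_add_left]; push_cast; ring
  | neg x _ hx => rw [C.e_neg, Pi.neg_apply, hx, inner_neg_left]; push_cast; ring

lemma int' {α : E} (hα : α ∈ Δ) {x : E} (hx : x ∈ AddSubgroup.closure Δ) :
    ∃ n : ℤ, 2 * ⟪x, α⟫ / ⟪α, α⟫ = (n : ℝ) := by
  induction hx using AddSubgroup.closure_induction with
  | mem x hx => exact C.crys α hα x hx
  | zero => exact ⟨0, by simp⟩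
  | add x y _ _ hx hy =>
    obtain ⟨n, hn⟩ := hx
    obtain ⟨m, hm⟩ := hy
    refine ⟨n + m, ?_⟩
    push_cast
    rw [← hn, ← hm, inner_add_left]; ring
  | neg x _ hx =>
    obtain ⟨n, hn⟩ := hx
    refine ⟨-n, ?_⟩
    push_cast
    rw [← hn, inner_neg_left]; ring

lemma cone_lat {x : E} (hx : x ∈ AddSubmonoid.closure Φ) : x ∈ AddSubgroup.closure Δ :=
  (AddSubmonoid.closure_le (S := (AddSubgroup.closure Δ).toAddSubmonoid)).2
    (fun _ h => AddSubgroup.subset_closure (C.ΦΔ h)) hx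

lemma pow_e {α : E} (hα : α ∈ Δ) {μ : E} {v : M} (hv : v ∈ hwt H M (e μ)) (n : ℕ) :
    ((LieModule.toEnd ℂ L M (ec α)) ^ n) v ∈ hwt H M (e (μ + (n : ℝ) • α)) := by
  induction n with
  | zero => simpa using hv
  | succ n ih =>
    rw [pow_succ', Module.End.mul_apply, LieModule.toEnd_apply_apply]
    have := hwt_lie (C.ecm α hα) ih
    rw [← C.add] at this
    convert this using 3
    push_cast
    module

lemma pow_f {α : E} (hα : α ∈ Δ) {μ : E} {v : M} (hv : v ∈ hwt H M (e μ)) (n : ℕ) :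
    ((LieModule.toEnd ℂ L M (fc α)) ^ n) v ∈ hwt H M (e (μ - (n : ℝ) • α)) := by
  induction n with
  | zero => simpa using hv
  | succ n ih =>
    rw [pow_succ', Module.End.mul_apply, LieModule.toEnd_apply_apply]
    have := hwt_lie (C.fcm α hα) ih
    rw [← C.add] at this
    convert this using 3
    push_cast
    module

lemma wt_refl [H.IsCartanSubalgebra] [FiniteDimensional ℂ M] {α : E} (hα : α ∈ Δ) {μ : E}
    (hμ : hwt H M (e μ) ≠ ⊥) {k : ℕ} (hk : e μ (hc α) = -(k : ℂ)) :
    hwt H M (e (μ + (k : ℝ) • α)) ≠ ⊥ := by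
  obtain ⟨v, hv, hv0⟩ := Submodule.exists_mem_ne_zero_of_ne_bot hμ
  have hex : ∃ n : ℕ, ((LieModule.toEnd ℂ L M (fc α)) ^ n) v = 0 := by
    by_contra! hcon
    have hinf : (Set.range fun n : ℕ => μ - (n : ℝ) • α).Infinite := by
      refine Set.infinite_range_of_injective fun i j hij => ?_
      have h2 : ((i : ℝ) - j) • α = 0 := by
        rw [sub_smul, sub_eq_zero]
        exact sub_right_injective hij
      rcases smul_eq_zero.1 h2 with h3 | h3
      · exact_mod_cast sub_eq_zero.1 h3
      · exact absurd h3 (C.ne0 hα)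
    refine hinf ((C.wt_fin (M := M)).subset ?_)
    rintro _ ⟨n, rfl⟩ hb
    have := C.pow_f hα hv n
    rw [hb] at this
    exact hcon n ((Submodule.mem_bot ℂ).1 this)
  obtain ⟨i, hi1, hi2⟩ := Nat.exists_not_and_succ_of_not_zero_of_exists
    (p := fun n => ((LieModule.toEnd ℂ L M (fc α)) ^ n) v = 0) (by simpa using hv0) hex
  set w := ((LieModule.toEnd ℂ L M (fc α)) ^ i) v with hw
  have hwm := C.pow_f hα hv i
  rw [← hw] at hwm
  have hαα : e α (hc α) = 2 := by
    rw [C.comp α hα α hα, mul_div_assoc, div_self (C.ip hα).ne']; norm_num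
  have heig : ⁅(hc α : L), v⁆ = (-(k : ℂ)) • v := by rw [hv (hc α), hk]
  have P : (C.tri α hα).symm.HasPrimitiveVectorWith w ((k + 2 * i : ℕ) : ℂ) := by
    refine ⟨hi1, ?_, ?_⟩
    · have := (C.tri α hα).symm.lie_h_pow_toEnd_e (R := ℂ) (m := v) (μ := (k : ℂ))
        (by rw [neg_lie, heig, neg_smul, neg_neg]) i
      rw [← hw] at this
      rw [this]; push_cast; rfl
    · rw [pow_succ', Module.End.mul_apply, LieModule.toEnd_apply_apply] at hi2
      exact hi2
  have hne := P.pow_toEnd_f_ne_zero_of_eq_nat rfl (i := i + k) (by omega)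
  have hm := C.pow_e hα hwm (i + k)
  have heq : μ - (i : ℝ) • α + ((i + k : ℕ) : ℝ) • α = μ + (k : ℝ) • α := by
    push_cast; module
  rw [heq] at hm
  intro hb
  rw [hb] at hm
  exact hne ((Submodule.mem_bot ℂ).1 hm)

end Ctx
end part3
section part4
lemma nrm_refl {E : Type} [NormedAddCommGroup E] [InnerProductSpace ℝ E] (x α : E) (hα : 0 < ⟪α, α⟫) : ‖x - (2 * ⟪x, α⟫ / ⟪α, α⟫) • α‖ = ‖x‖ := by
  rw [← sq_eq_sq₀ (norm_nonneg _) (norm_nonneg _), ← real_inner_self_eq_norm_sq,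
    ← real_inner_self_eq_norm_sq, inner_sub_left, inner_sub_right, inner_sub_right,
    real_inner_smul_left, real_inner_smul_left, real_inner_smul_right, real_inner_smul_right,
    real_inner_comm x α]
  field_simp
  ring

namespace Ctx
variable {E : Type} [NormedAddCommGroup E] [InnerProductSpace ℝ E] {Δ Δp Φ : Set E}
    {L : Type} [LieRing L] [LieAlgebra ℂ L] {H : LieSubalgebra ℂ L} {e : E → H → ℂ}
    {hc : E → H} {ec fc : E → L} {b : Module.Basis Φ ℝ E}
    (C : Ctx Δ Δp Φ H e hc ec fc b)
  {M : Type} [AddCommGroup M] [Module ℂ M] [LieRingModule L M] [LieModule ℂ L M]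

include C

lemma repr_simple {a : E} (ha : a ∈ Φ) [DecidableEq E] (a' : Φ) :
    b.repr a a' = if a = a' then 1 else 0 := by
  classical
  have : b.repr a = b.repr (b ⟨a, ha⟩) := by rw [C.b_apply]
  rw [this, Module.Basis.repr_self, Finsupp.single_apply]
  simp [Subtype.ext_iff]

lemma ht_ex [Fintype Φ] : ∃ ht : E →ₗ[ℝ] ℝ, ∀ a ∈ Φ, ht a = 1 := by
  refine ⟨b.constr ℝ (fun _ => (1 : ℝ)), fun a ha => ?_⟩
  have := b.constr_basis ℝ (fun _ => (1 : ℝ)) ⟨a, ha⟩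
  rwa [C.b_apply] at this

lemma not_root {a a' : E} (ha : a ∈ Φ) (ha' : a' ∈ Φ) (hne : a ≠ a') {t : ℝ} (ht : 0 < t) :
    a - t • a' ∉ Δ := by
  classical
  intro h
  rcases C.pm _ h with h1 | h1
  · have := C.repr_nn (C.pos _ h1) ⟨a', ha'⟩
    rw [map_sub, map_smul, Finsupp.sub_apply, Finsupp.smul_apply, C.repr_simple ha,
      C.repr_simple ha'] at this
    simp [hne] at this
    linarith
  · have := C.repr_nn (C.pos _ h1) ⟨a, ha⟩
    rw [map_neg, map_sub, map_smul, Finsupp.neg_apply, Finsupp.sub_apply, Finsupp.smul_apply,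
      C.repr_simple ha, C.repr_simple ha'] at this
    simp [hne.symm] at this
    linarith

lemma simple_inner {a a' : E} (ha : a ∈ Φ) (ha' : a' ∈ Φ) (hne : a ≠ a') : ⟪a, a'⟫ ≤ 0 := by
  by_contra! h
  refine C.not_root ha ha' hne ?_ (C.refl a' (C.ΦΔ ha') a (C.ΦΔ ha))
  have := C.ip (C.ΦΔ ha')
  positivity

lemma norm_bound [Fintype Φ] [H.IsCartanSubalgebra] [FiniteDimensional ℂ M] {θ : E} (hθ : θ ∈ Δ)
    (hwts : ∀ χ, hwt H M χ ≠ ⊥ → ∃ β ∈ AddSubmonoid.closure Φ, χ = e (θ - β))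
    {μ : E} (hμ : hwt H M (e μ) ≠ ⊥) : ‖μ‖ ≤ ‖θ‖ := by
  obtain ⟨ht, hht⟩ := C.ht_ex
  have hT : {x : E | hwt H M (e x) ≠ ⊥ ∧ ‖x‖ = ‖μ‖}.Finite :=
    (C.wt_fin (M := M)).subset fun x hx => hx.1
  obtain ⟨l, ⟨hl1, hl2⟩, hmax⟩ := Set.exists_max_image _ ht hT ⟨μ, hμ, rfl⟩
  obtain ⟨β, hβ, hlβ⟩ := hwts _ hl1
  have hlβ := C.inj hlβ
  have hlat : l ∈ AddSubgroup.closure Δ := by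
    rw [hlβ]; exact sub_mem (AddSubgroup.subset_closure hθ) (C.cone_lat hβ)
  have hdom : ∀ a ∈ Φ, 0 ≤ ⟪a, l⟫ := by
    intro a ha
    by_contra! hneg
    have haΔ := C.ΦΔ ha
    obtain ⟨n, hn⟩ := C.int' haΔ hlat
    have hn0 : (n : ℝ) < 0 := by
      rw [← hn]
      rw [real_inner_comm] at hneg
      exact div_neg_of_neg_of_pos (by linarith) (C.ip haΔ)
    have hn0' : n < 0 := by exact_mod_cast hn0
    obtain ⟨k, hk⟩ := Int.eq_ofNat_of_zero_le (a := -n) (by omega)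
    have hnk : (n : ℝ) = -(k : ℝ) := by
      have : n = -(k : ℤ) := by omega
      rw [this]; push_cast; rfl
    have h1 := C.wt_refl haΔ hl1 (k := k) (by
      rw [C.comp' haΔ hlat, hn, hnk]; push_cast; rfl)
    have h2 : ‖l + (k : ℝ) • a‖ = ‖μ‖ := by
      rw [← hl2, ← nrm_refl l a (C.ip haΔ), hn, hnk, neg_smul, sub_neg_eq_add]
    have h3 := hmax _ ⟨h1, h2⟩
    rw [map_add, map_smul, hht a ha, smul_eq_mul] at h3
    linarith
  have hin : 0 ≤ ⟪θ - l, l⟫ := by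
    refine C.inner_cone (fun a => ?_) hdom
    rw [hlβ, sub_sub_cancel]
    exact C.repr_nn hβ a
  rw [inner_sub_left, real_inner_self_eq_norm_sq] at hin
  have hcs := real_inner_le_norm θ l
  rw [← hl2]
  have h0 := norm_nonneg l
  have h0' := norm_nonneg θ
  by_contra! hlt
  nlinarith

lemma short_one [Fintype Φ] [H.IsCartanSubalgebra] [FiniteDimensional ℂ M] {θ : E} (hθ : θ ∈ Δ)
    (hmin : ∀ β ∈ Δ, ‖θ‖ ≤ ‖β‖)
    (hhigh : ∀ γ ∈ Δ, ‖γ‖ = ‖θ‖ → ∀ a, 0 ≤ b.repr (θ - γ) a)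
    {γ : E} (hγ : γ ∈ Δp) (hγθ : ‖γ‖ = ‖θ‖) :
    Module.finrank ℂ (hwt H M (e γ)) = Module.finrank ℂ (hwt H M (e θ)) := by
  obtain ⟨ht, hht⟩ := C.ht_ex
  have hT : {x : E | x ∈ Δp ∧ ‖x‖ = ‖θ‖ ∧
      Module.finrank ℂ (hwt H M (e x)) = Module.finrank ℂ (hwt H M (e γ))}.Finite :=
    C.fin.subset fun x hx => C.pΔ hx.1
  obtain ⟨l, ⟨hl1, hl2, hl3⟩, hmax⟩ := Set.exists_max_image _ ht hT ⟨γ, hγ, hγθ, rfl⟩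
  have hlΔ := C.pΔ hl1
  have hdom : ∀ a ∈ Φ, 0 ≤ ⟪a, l⟫ := by
    intro a ha
    by_contra! hneg
    rw [real_inner_comm] at hneg
    have haΔ := C.ΦΔ ha
    obtain ⟨n, hn⟩ := C.crys a haΔ l hlΔ
    have hap := C.ip haΔ
    have hn0 : (n : ℝ) < 0 := by
      rw [← hn]
      exact div_neg_of_neg_of_pos (by linarith) hap
    have hn0' : n < 0 := by exact_mod_cast hn0
    have hstrict : -⟪l, a⟫ < ‖l‖ * ‖a‖ := by
      rw [← inner_neg_left, ← norm_neg l]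
      refine lt_of_le_of_ne (real_inner_le_norm _ _) fun heq => ?_
      rw [inner_eq_norm_mul_iff_real] at heq
      have hla : 0 < ‖a‖ := norm_pos_iff.2 (C.ne0 haΔ)
      have hll : 0 < ‖-l‖ := by rw [norm_neg]; exact norm_pos_iff.2 (C.ne0 hlΔ)
      have h1 : l = (-(‖-l‖ / ‖a‖)) • a := by
        have : ‖a‖⁻¹ • (‖a‖ • -l) = ‖a‖⁻¹ • (‖-l‖ • a) := by rw [heq]
        rw [smul_smul, inv_mul_cancel₀ hla.ne', one_smul, smul_smul] at this
        rw [neg_smul, div_eq_inv_mul, ← this, neg_neg]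
      have h2 := C.red a haΔ _ (h1 ▸ hlΔ)
      have h3 : 0 < ‖-l‖ / ‖a‖ := by positivity
      have h4 : l = -a := by
        rcases h2 with h2 | h2
        · linarith
        · rw [h2] at h1; simpa using h1
      refine C.ne0 hlΔ (C.cone_zero (C.pos l hl1) ?_)
      rw [h4, neg_neg]
      exact AddSubmonoid.subset_closure ha
    have hn1 : n = -1 := by
      have hla : ‖l‖ ≤ ‖a‖ := hl2 ▸ hmin a haΔ
      have : -(2 : ℝ) < n := by
        rw [← hn, lt_div_iff₀ hap, real_inner_self_eq_norm_sq]
        nlinarith [norm_nonneg a]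
      have : -2 < n := by exact_mod_cast this
      omega
    have hn' : 2 * ⟪l, a⟫ / ⟪a, a⟫ = -1 := by rw [hn, hn1]; norm_num
    have hlaΔ : l + a ∈ Δ := by
      have := C.refl a haΔ l hlΔ
      rw [hn'] at this
      simpa using this
    have hnorm : ‖l + a‖ = ‖θ‖ := by
      have := nrm_refl l a hap
      rw [hn'] at this
      rw [← hl2, ← this]
      simp
    have hcone : l + a ∈ AddSubmonoid.closure Φ :=
      add_mem (C.pos l hl1) (AddSubmonoid.subset_closure ha)
    have hlap : l + a ∈ Δp := by
      refine (C.pm _ hlaΔ).resolve_right fun h => C.ne0 hlaΔ (C.cone_zero hcone (C.pos _ h))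
    have hfr : Module.finrank ℂ (hwt H M (e (l + a))) = Module.finrank ℂ (hwt H M (e l)) := by
      apply le_antisymm
      · refine LinearMap.finrank_le_finrank_of_injective
          (f := (adm L M (fc a)).restrict (p := hwt H M (e (l + a))) (q := hwt H M (e l)) ?_) ?_
        · intro v hv
          have := hwt_lie (C.fcm a haΔ) hv
          rw [← C.add, show -a + (l + a) = l by abel] at this
          exact this
        · rw [injective_iff_map_eq_zero]
          rintro ⟨v, hv⟩ h
          have h' : ⁅fc a, v⁆ = 0 := congrArg Subtype.val h
          apply Subtype.ext
          refine sl2_f_inj (C.tri a haΔ) (c := 1) ?_ one_pos h'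
          rw [hv (hc a), C.comp a haΔ _ hlaΔ, inner_add_left, mul_add, add_div, hn',
            mul_div_assoc 2 ⟪a, a⟫, div_self hap.ne']
          norm_num
      · refine LinearMap.finrank_le_finrank_of_injective
          (f := (adm L M (ec a)).restrict (p := hwt H M (e l)) (q := hwt H M (e (l + a))) ?_) ?_
        · intro v hv
          have := hwt_lie (C.ecm a haΔ) hv
          rw [← C.add, add_comm] at this
          exact this
        · rw [injective_iff_map_eq_zero]
          rintro ⟨v, hv⟩ h
          have h' : ⁅ec a, v⁆ = 0 := congrArg Subtype.val h
          apply Subtype.ext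
          refine sl2_e_inj (C.tri a haΔ) (c := -1) ?_ (by norm_num) h'
          rw [hv (hc a), C.comp a haΔ _ hlΔ, hn']
    have h3 := hmax _ ⟨hlap, hnorm, hfr.trans hl3⟩
    rw [map_add, hht a ha] at h3
    linarith
  have hin : 0 ≤ ⟪θ - l, l⟫ := C.inner_cone (hhigh l hlΔ hl2) hdom
  have hz : θ - l = 0 := by
    rw [← norm_eq_zero, ← sq_eq_zero_iff]
    have h1 := norm_sub_sq_real θ l
    rw [inner_sub_left, real_inner_self_eq_norm_sq] at hin
    rw [hl2] at *
    nlinarith [sq_nonneg ‖θ - l‖]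
  rw [← hl3, sub_eq_zero.1 hz]

lemma kill [Fintype Φ] [FiniteDimensional ℂ M] {v : M} (hv : v ∈ hwt H M (e 0))
    (hk : ∀ a ∈ Φ, ⁅ec a, v⁆ = 0) : ∀ γ ∈ Δp, ∀ x ∈ hwt H L (e γ), ⁅x, v⁆ = 0 := by
  classical
  obtain ⟨ht, hht⟩ := C.ht_ex
  have hH : ∀ x ∈ H.toSubmodule, ⁅x, v⁆ = 0 := by
    intro x hx
    have := hv ⟨x, hx⟩
    rw [C.e_zero, Pi.zero_apply, zero_smul] at this
    exact this
  have hf : ∀ a ∈ Φ, ⁅fc a, v⁆ = 0 := fun a ha =>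
    sl2_zero (C.tri a (C.ΦΔ ha)) (hH _ (hc a).2) (hk a ha)
  by_contra! hcon
  have hfin : {γ | γ ∈ Δp ∧ ∃ x ∈ hwt H L (e γ), ⁅x, v⁆ ≠ 0}.Finite :=
    C.fin.subset fun x hx => C.pΔ hx.1
  obtain ⟨γ, ⟨hγ, x, hx, hne⟩, hmin⟩ := Set.exists_min_image _ ht hfin hcon
  have hγΔ := C.pΔ hγ
  have hex : ∃ a ∈ Φ, 0 < ⟪γ, a⟫ := by
    by_contra! h
    have : 0 ≤ ⟪γ, -γ⟫ := by
      refine C.inner_cone (C.repr_nn (C.pos γ hγ)) fun a ha => ?_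
      rw [inner_neg_right, real_inner_comm]
      linarith [h a ha]
    rw [inner_neg_right] at this
    linarith [C.ip hγΔ]
  obtain ⟨a, ha, hpos⟩ := hex
  have haΔ := C.ΦΔ ha
  have hxv := hwt_lie hx hv
  rw [← C.add, add_zero] at hxv
  refine hne (sl2_f_inj (C.tri a haΔ) (c := 2 * ⟪γ, a⟫ / ⟪a, a⟫) ?_ ?_ ?_)
  · rw [hxv (hc a), C.comp a haΔ γ hγΔ]
  · have := C.ip haΔ
    positivity
  · rw [leibniz_lie, hf a ha, lie_zero, add_zero]
    have hm := hwt_lie (C.fcm a haΔ) hx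
    rw [← C.add, neg_add_eq_sub] at hm
    by_cases hγa : γ = a
    · rw [hγa, sub_self, C.e_zero] at hm
      exact hH _ (C.zero hm)
    by_cases hb : hwt H L (e (γ - a)) = ⊥
    · rw [hb] at hm
      rw [(Submodule.mem_bot ℂ).1 hm, zero_lie]
    have hr := C.root (γ - a) (sub_ne_zero.2 hγa) hb
    have hp : γ - a ∈ Δp := by
      refine (C.pm _ hr).resolve_right fun h => hγa ?_
      have h1 : γ = (b.repr γ ⟨a, ha⟩) • a := by
        apply b.repr.injective
        ext a'
        rw [map_smul, Finsupp.smul_apply, C.repr_simple ha]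
        by_cases haa : a = a'
        · subst haa; simp
        · have h2 := C.repr_nn (C.pos _ h) a'
          have h3 := C.repr_nn (C.pos _ hγ) a'
          rw [neg_sub, map_sub, Finsupp.sub_apply, C.repr_simple ha, if_neg haa] at h2
          rw [if_neg haa, smul_zero]
          linarith
      have h2 := C.red a haΔ _ (h1 ▸ hγΔ)
      rcases h2 with h2 | h2
      · rw [h2, one_smul] at h1; exact h1
      · have := C.repr_nn (C.pos _ hγ) ⟨a, ha⟩
        linarith
    by_contra hne'
    have := hmin _ ⟨hp, _, hm, hne'⟩
    rw [map_sub, hht a ha] at this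
    linarith

lemma principal [Fintype Φ] [FiniteDimensional ℝ E] [Nonempty Φ] :
    ∃ (h : H) (c : Φ → ℂ), (∀ a ∈ Φ, e a h = 2) ∧
      IsSl2Triple (h : L) (∑ a : Φ, ec a) (∑ a : Φ, c a • fc a) := by
  classical
  obtain ⟨ht, hht⟩ := C.ht_ex
  let x : E := (InnerProductSpace.toDual ℝ E).symm (LinearMap.toContinuousLinearMap ht)
  have hx : ∀ y, ⟪x, y⟫ = ht y := fun y => by simp [x]
  let c : Φ → ℂ := fun a => ((b.repr x a * ⟪(a : E), (a : E)⟫ : ℝ) : ℂ)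
  let h : H := ∑ a : Φ, c a • hc a
  have elin : ∀ a ∈ Φ, ∀ y z : H, e a (y + z) = e a y + e a z := by
    intro a ha y z
    have hm := C.ecm a (C.ΦΔ ha)
    have hne := (C.tri a (C.ΦΔ ha)).e_ne_zero
    have := hm (y + z)
    change ⁅(y : L) + (z : L), ec a⁆ = _ at this
    rw [add_lie, hm y, hm z, ← add_smul] at this
    exact (smul_left_injective ℂ hne this).symm
  have elin2 : ∀ a ∈ Φ, ∀ (r : ℂ) (z : H), e a (r • z) = r * e a z := by
    intro a ha r z
    have hm := C.ecm a (C.ΦΔ ha)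
    have hne := (C.tri a (C.ΦΔ ha)).e_ne_zero
    have := hm (r • z)
    change ⁅r • (z : L), ec a⁆ = _ at this
    rw [smul_lie, hm z, smul_smul] at this
    exact (smul_left_injective ℂ hne this).symm
  have eh : ∀ a ∈ Φ, e a h = 2 := by
    intro a ha
    let el : H →ₗ[ℂ] ℂ := ⟨⟨e a, elin a ha⟩, elin2 a ha⟩
    have h1 : e a h = ∑ a' : Φ, c a' * e a (hc a') := by
      change el h = _
      rw [map_sum]
      refine Finset.sum_congr rfl fun a' _ => ?_
      rw [map_smul]; rfl
    have h2 : ∑ a' : Φ, c a' * e a (hc a') = ((∑ a' : Φ, 2 * (b.repr x a' * ⟪a, (a' : E)⟫) : ℝ) : ℂ) := by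
      rw [Complex.ofReal_sum]
      refine Finset.sum_congr rfl fun a' _ => ?_
      have hne : (⟪(a' : E), (a' : E)⟫ : ℝ) ≠ 0 := (C.ip (C.ΦΔ a'.2)).ne'
      rw [C.comp a' (C.ΦΔ a'.2) a (C.ΦΔ ha)]
      simp only [c]
      rw [← Complex.ofReal_mul]
      congr 1
      field_simp
    have h3 : ∑ a' : Φ, 2 * (b.repr x a' * ⟪a, (a' : E)⟫) = 2 * ⟪a, x⟫ := by
      conv_rhs => rw [← b.sum_repr x, inner_sum]
      rw [Finset.mul_sum]
      refine Finset.sum_congr rfl fun a' _ => ?_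
      rw [real_inner_smul_right, C.b_apply]
    rw [h1, h2, h3, real_inner_comm, hx, hht a ha]
    norm_num
  refine ⟨h, c, eh, ?_, ?_, ?_, ?_⟩
  · intro h0
    obtain ⟨a⟩ := ‹Nonempty Φ›
    have h1 := C.ecm a (C.ΦΔ a.2) h
    rw [h0, zero_lie, eh a a.2] at h1
    have hne := (C.tri a (C.ΦΔ a.2)).e_ne_zero
    rcases smul_eq_zero.1 h1.symm with h2 | h2
    · norm_num at h2
    · exact hne h2
  · have hcoe : (h : L) = ∑ a : Φ, c a • (hc a : L) := by
      change H.toSubmodule.subtype h = _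
      rw [map_sum]; rfl
    rw [hcoe, sum_lie]
    refine Finset.sum_congr rfl fun a _ => ?_
    rw [lie_sum, Finset.sum_eq_single a]
    · rw [lie_smul, (C.tri a (C.ΦΔ a.2)).lie_e_f]
    · intro a' _ hne
      rw [lie_smul]
      have hm := hwt_lie (C.ecm a (C.ΦΔ a.2)) (C.fcm a' (C.ΦΔ a'.2))
      rw [← C.add, ← sub_eq_add_neg] at hm
      have hne' : (a : E) ≠ a' := fun h => hne (Subtype.ext h.symm)
      have hb : hwt H L (e ((a : E) - a')) = ⊥ := by
        by_contra hb
        have := C.root _ (sub_ne_zero.2 hne') hb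
        refine C.not_root a.2 a'.2 hne' one_pos (by rwa [one_smul])
      rw [hb] at hm
      rw [(Submodule.mem_bot ℂ).1 hm, smul_zero]
    · simp
  · rw [lie_sum, Finset.smul_sum]
    refine Finset.sum_congr rfl fun a _ => ?_
    rw [C.ecm a (C.ΦΔ a.2) h, eh a a.2, ofNat_smul_eq_nsmul]
  · rw [lie_sum, Finset.smul_sum, ← Finset.sum_neg_distrib]
    refine Finset.sum_congr rfl fun a _ => ?_
    rw [lie_smul, C.fcm a (C.ΦΔ a.2) h, C.e_neg, Pi.neg_apply, eh a a.2, neg_smul, smul_neg,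
      ofNat_smul_eq_nsmul, smul_comm]

lemma final [Fintype Φ] [Nontrivial M] [H.IsCartanSubalgebra] [FiniteDimensional ℝ E]
    [FiniteDimensional ℂ M] [Nonempty Φ]
    (hMsimple : ∀ N : LieSubmodule ℂ L M, N = ⊥ ∨ N = ⊤)
    {θ : E} (hθ : θ ∈ Δp) (hmin : ∀ β ∈ Δ, ‖θ‖ ≤ ‖β‖)
    (hθw : hwt H M (e θ) ≠ ⊥)
    (hwts : ∀ χ, hwt H M χ ≠ ⊥ → ∃ β ∈ AddSubmonoid.closure Φ, χ = e (θ - β)) :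
    Module.finrank ℂ (hwt H M (0 : H → ℂ)) = ∑ a : Φ, Module.finrank ℂ (hwt H M (e a)) := by
  classical
  rw [← Module.finrank_pi_fintype]
  apply le_antisymm
  · let φ : (hwt H M (0 : H → ℂ)) →ₗ[ℂ] ((a : Φ) → hwt H M (e a)) :=
      LinearMap.pi fun a : Φ => (adm L M (ec a)).restrict fun v hv => by
        have := hwt_lie (C.ecm a (C.ΦΔ a.2)) hv
        rw [add_zero] at this
        exact this
    refine LinearMap.finrank_le_finrank_of_injective (f := φ) ?_
    rw [injective_iff_map_eq_zero]
    rintro ⟨v, hv⟩ h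
    by_contra hne
    have hv0 : v ≠ 0 := fun h => hne (Subtype.ext h)
    rw [← C.e_zero] at hv
    have hk := C.kill hv fun a ha => congrArg Subtype.val (congrFun h ⟨a, ha⟩)
    obtain ⟨β, hβ, hh⟩ := C.hw_wt hMsimple hv0 hv hk _ hθw
    have hh := C.inj hh
    rw [zero_sub] at hh
    refine C.ne0 (C.pΔ hθ) (C.cone_zero (C.pos θ hθ) ?_)
    rw [hh, neg_neg]; exact hβ
  · obtain ⟨h, c, heh, t⟩ := C.principal
    let ψ : ((a : Φ) → hwt H M (e a)) →ₗ[ℂ] (hwt H M (0 : H → ℂ)) :=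
      ∑ a : Φ, c a • ((adm L M (fc a)).restrict (p := hwt H M (e a)) (q := hwt H M 0)
        (fun v hv => by
          have := hwt_lie (C.fcm a (C.ΦΔ a.2)) hv
          rw [← C.add, neg_add_cancel, C.e_zero] at this
          exact this)).comp (LinearMap.proj a)
    refine LinearMap.finrank_le_finrank_of_injective (f := ψ) ?_
    rw [injective_iff_map_eq_zero]
    intro w hw
    have hval : ∑ a : Φ, c a • ⁅fc a, (w a : M)⁆ = 0 := by
      have : ((ψ w : hwt H M (0 : H → ℂ)) : M) = ∑ a : Φ, c a • ⁅fc a, (w a : M)⁆ := by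
        simp only [ψ, LinearMap.sum_apply, Submodule.coe_sum]
        rfl
      rw [← this, hw]; rfl
    let s : M := ∑ a : Φ, (w a : M)
    have hs : s = 0 := by
      refine sl2_f_inj t (c := 2) ?_ two_pos ?_
      · rw [lie_sum, Finset.smul_sum]
        refine Finset.sum_congr rfl fun a _ => ?_
        rw [(w a).2 h, heh a a.2]; norm_num
      · rw [sum_lie, ← hval]
        refine Finset.sum_congr rfl fun a _ => ?_
        rw [smul_lie, lie_sum, Finset.sum_eq_single a]
        · intro a' _ hne
          have hne' : (a' : E) ≠ a := fun h => hne (Subtype.ext h)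
          have hm := hwt_lie (C.fcm a (C.ΦΔ a.2)) (w a').2
          rw [← C.add, neg_add_eq_sub] at hm
          have hb : hwt H M (e ((a' : E) - a)) = ⊥ := by
            by_contra hb
            have h1 := C.norm_bound (C.pΔ hθ) hwts hb
            have h2 := norm_sub_sq_real (a' : E) a
            have h3 := C.simple_inner a'.2 a.2 hne'
            have h4 := hmin _ (C.ΦΔ a.2)
            have h5 := hmin _ (C.ΦΔ a'.2)
            have h6 : 0 < ‖θ‖ := norm_pos_iff.2 (C.ne0 (C.pΔ hθ))
            have h7 := norm_nonneg ((a' : E) - a)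
            nlinarith
          rw [hb] at hm
          exact (Submodule.mem_bot ℂ).1 hm
        · simp
    have hind : iSupIndep (fun a : Φ => hwt H M (e a)) :=
      (hwt_indep (H := H) (M := M)).comp (f := fun a : Φ => e a)
        (C.inj.comp Subtype.val_injective)
    funext a
    apply Subtype.ext
    refine Submodule.disjoint_def.1 (hind a) _ (w a).2 ?_
    have : (w a : M) = - ∑ a' ∈ Finset.univ.erase a, (w a' : M) := by
      rw [eq_neg_iff_add_eq_zero, Finset.add_sum_erase _ (fun a => (w a : M)) (Finset.mem_univ a)]
      exact hs
    rw [this]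
    refine neg_mem (sum_mem fun a' ha' => ?_)
    exact Submodule.mem_iSup_of_mem a' (Submodule.mem_iSup_of_mem (Finset.ne_of_mem_erase ha') (w a').2)

end Ctx
end part4
/-- The dimension of the zero weight space of the little adjoint module
equals the number of short simple roots: `dim V_{θs}^0 = #Πs`. -/
theorem statement4
    {E : Type} [NormedAddCommGroup E] [InnerProductSpace ℝ E] [FiniteDimensional ℝ E]
    (Δ Δs Δl Δp Φ Φs : Set E)
    -- `Δ` is a reduced crystallographic root system in `E`
    (hfin : Δ.Finite) (h0 : (0 : E) ∉ Δ)
    (hspan : Submodule.span ℝ Δ = ⊤)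
    (hrefl : ∀ α ∈ Δ, ∀ β ∈ Δ, rrefl α β ∈ Δ)
    (hcrys : ∀ α ∈ Δ, ∀ β ∈ Δ, ∃ n : ℤ, 2 * ⟪β, α⟫ / ⟪α, α⟫ = (n : ℝ))
    (hred : ∀ α ∈ Δ, ∀ t : ℝ, t • α ∈ Δ → t = 1 ∨ t = -1)
    -- irreducible
    (hirr : ∀ A B : Set E, A ∪ B = Δ → (∀ a ∈ A, ∀ b ∈ B, ⟪a, b⟫ = 0) → A = ∅ ∨ B = ∅)
    -- two root lengths: `Δs` are the short roots, `Δl` the long ones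
    (ls ll : ℝ) (h0ls : 0 < ls) (hlsll : ls < ll)
    (hΔs : Δs = {α ∈ Δ | ‖α‖ = ls}) (hΔl : Δl = {α ∈ Δ | ‖α‖ = ll})
    (hcover : Δ = Δs ∪ Δl) (hsne : Δs.Nonempty) (hlne : Δl.Nonempty)
    -- `Δp` is a positive system with simple roots `Φ`; `Φs = Φ ∩ Δs`
    (hΔpΔ : Δp ⊆ Δ) (hpm : ∀ α ∈ Δ, α ∈ Δp ↔ -α ∉ Δp)
    (hΦp : Φ ⊆ Δp)
    (hΦind : LinearIndependent ℝ (fun a : Φ => (a : E)))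
    (hΦdec : ∀ γ ∈ Δp, ∃ c : E →₀ ℕ, ↑c.support ⊆ Φ ∧ γ = c.sum fun α n => (n : ℝ) • α)
    (hΦs : Φs = Φ ∩ Δs)
    -- `θs` is the highest short root
    (θs : E) (hθsmem : θs ∈ Δs ∩ Δp)
    (hθshigh : ∀ γ ∈ Δs, ∃ c : E →₀ ℝ, ↑c.support ⊆ Φ ∧ (∀ α, 0 ≤ c α) ∧
      θs - γ = c.sum fun α t => t • α)
    -- `L` is a complex simple Lie algebra with Cartan subalgebra `H`, whose root system
    -- is identified with `Δ` via `e`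
    (L : Type) [LieRing L] [LieAlgebra ℂ L] [FiniteDimensional ℂ L]
    [LieAlgebra.IsSimple ℂ L]
    (H : LieSubalgebra ℂ L) [H.IsCartanSubalgebra]
    (e : E → H → ℂ)
    (headd : ∀ a b : E, e (a + b) = e a + e b)
    (heinj : Function.Injective e)
    (hroots1 : ∀ μ ∈ Δ, hwt H L (e μ) ≠ ⊥)
    (hroots2 : ∀ χ : H → ℂ, χ ≠ 0 → hwt H L χ ≠ ⊥ → ∃ μ ∈ Δ, χ = e μ)
    -- `M` is the little adjoint module `V_{θs}`: the (finite-dimensional) simple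
    -- `L`-module with highest weight `θs`
    (M : Type) [AddCommGroup M] [Module ℂ M] [LieRingModule L M] [LieModule ℂ L M]
    [FiniteDimensional ℂ M] [Nontrivial M]
    (hMsimple : ∀ N : LieSubmodule ℂ L M, N = ⊥ ∨ N = ⊤)
    (hhw : ∃ v : M, v ≠ 0 ∧ v ∈ hwt H M (e θs) ∧
      ∀ γ ∈ Δp, ∀ x ∈ hwt H L (e γ), ⁅x, v⁆ = 0)
 :
    Module.finrank ℂ ↥(hwt H M (0 : H → ℂ)) = Φs.ncard := by
  classical
  have hΦfin : Φ.Finite := hfin.subset (hΦp.trans hΔpΔ)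
  haveI : Fintype Φ := hΦfin.fintype
  have hpos : ∀ γ ∈ Δp, γ ∈ AddSubmonoid.closure Φ := by
    intro γ hγ
    obtain ⟨c, hc, rfl⟩ := hΦdec γ hγ
    refine sum_mem fun a ha => ?_
    change ((c a : ℕ) : ℝ) • a ∈ _
    rw [Nat.cast_smul_eq_nsmul]
    exact AddSubmonoid.nsmul_mem _ (AddSubmonoid.subset_closure (hc ha)) _
  have hpm' : ∀ α ∈ Δ, α ∈ Δp ∨ -α ∈ Δp := by
    intro α hα
    by_cases h : α ∈ Δp
    · exact Or.inl h
    · right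
      by_contra h'
      exact h ((hpm α hα).2 h')
  have hrefl' : ∀ α ∈ Δ, ∀ β ∈ Δ, β - (2 * ⟪β, α⟫ / ⟪α, α⟫) • α ∈ Δ := by
    intro α hα β hβ
    rw [← rrefl_eq]; exact hrefl α hα β hβ
  have hne0 : ∀ α ∈ Δ, α ≠ 0 := fun α hα h => h0 (h ▸ hα)
  have hneg : ∀ α ∈ Δ, -α ∈ Δ := by
    intro α hα
    have h1 := hrefl' α hα α hα
    have h2 : (⟪α, α⟫ : ℝ) ≠ 0 := (real_inner_self_pos.2 (hne0 α hα)).ne'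
    rw [mul_div_assoc, div_self h2, mul_one, two_smul] at h1
    simpa using h1
  have hcl : ∀ x ∈ AddSubmonoid.closure Φ, x ∈ Submodule.span ℝ Φ := fun x hx =>
    (AddSubmonoid.closure_le (S := (Submodule.span ℝ Φ).toAddSubmonoid)).2
      (fun _ h => Submodule.subset_span h) hx
  have hsp : ⊤ ≤ Submodule.span ℝ (Set.range fun a : Φ => (a : E)) := by
    rw [Subtype.range_coe, ← hspan, Submodule.span_le]
    intro α hα
    rcases hpm' α hα with h | h
    · exact hcl _ (hpos _ h)
    · have := neg_mem (hcl _ (hpos _ h))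
      rwa [neg_neg] at this
  let b : Module.Basis Φ ℝ E := Module.Basis.mk hΦind hsp
  have hb : ∀ a, b a = a := fun a => Module.Basis.mk_apply hΦind hsp a
  obtain ⟨hz, htop, hc, ec, fc, hdata⟩ := lie_data Δ h0 e headd heinj hroots1 hroots2
  have he0 : e 0 = 0 := by simpa using headd 0 0
  have hez : ∀ (j : ℤ) (a : E) (y : H), e (j • a) y = j * e a y := by
    intro j a y
    let f : E →+ ℂ := AddMonoidHom.mk' (fun a => e a y) (fun a b => by rw [headd]; rfl)
    have := map_zsmul f j a
    simpa [f] using this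
  have hcomp : ∀ α ∈ Δ, ∀ β ∈ Δ, e β (hc α) = ((2 * ⟪β, α⟫ / ⟪α, α⟫ : ℝ) : ℂ) := by
    intro α hα β hβ
    obtain ⟨t, hec, hfc, hs⟩ := hdata α hα
    have h2 : e α (hc α) = 2 := by
      have h3 := t.lie_h_e_nsmul
      rw [hec (hc α), ← ofNat_smul_eq_nsmul ℂ] at h3
      exact smul_left_injective ℂ t.e_ne_zero h3
    have haa : (⟪α, α⟫ : ℝ) ≠ 0 := (real_inner_self_pos.2 (hne0 α hα)).ne'
    obtain ⟨n, hn, -⟩ := hs β hβ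
    obtain ⟨m, hm⟩ := hcrys α hα β hβ
    have : n = m := by
      refine refl_unique hfin (hne0 α hα) hβ ?_ ?_
      · intro j hj
        obtain ⟨k, hk, hk'⟩ := hs _ hj
        rw [headd, Pi.add_apply, hn, hez, h2] at hk
        have hk2 : k = n + j * 2 := by exact_mod_cast hk.symm
        rw [hk2] at hk'
        convert hk' using 1
        module
      · intro j hj
        have h := hrefl' α hα _ hj
        have hk : 2 * ⟪β + j • α, α⟫ / ⟪α, α⟫ = ((m + 2 * j : ℤ) : ℝ) := by
          rw [← Int.cast_smul_eq_zsmul ℝ, inner_add_left, real_inner_smul_left, mul_add, add_div, hm]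
          push_cast
          field_simp
        rw [hk, Int.cast_smul_eq_zsmul] at h
        convert h using 1
        module
    rw [hn, hm, this]; norm_cast
  have C : Ctx Δ Δp Φ H e hc ec fc b :=
    { fin := hfin, h0 := h0, refl := hrefl', crys := hcrys, red := hred, pΔ := hΔpΔ
      pm := hpm', neg := hneg, Φp := hΦp, pos := hpos, b_apply := hb, add := headd
      inj := heinj
      root := by
        intro μ hμ h
        obtain ⟨μ', h1, h2⟩ := hroots2 (e μ) (fun h' => hμ (heinj (h'.trans he0.symm))) h
        rw [heinj h2]; exact h1
      zero := hz, top := htop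
      tri := fun α hα => (hdata α hα).1
      ecm := fun α hα => (hdata α hα).2.1
      fcm := fun α hα => (hdata α hα).2.2.1
      comp := hcomp }
  have hθΔ : θs ∈ Δ := hΔpΔ hθsmem.2
  have hθn : ‖θs‖ = ls := by
    have := hθsmem.1
    rw [hΔs] at this
    exact this.2
  have hmin : ∀ β ∈ Δ, ‖θs‖ ≤ ‖β‖ := by
    intro β hβ
    rw [hcover, hΔs, hΔl] at hβ
    rcases hβ with h | h
    · rw [hθn, h.2]
    · rw [hθn, h.2]; exact hlsll.le
  have hhigh : ∀ γ ∈ Δ, ‖γ‖ = ‖θs‖ → ∀ a, 0 ≤ b.repr (θs - γ) a := by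
    intro γ hγ hγn a
    obtain ⟨c, hc1, hc2, hc3⟩ := hθshigh γ (by rw [hΔs]; exact ⟨hγ, hγn.trans hθn⟩)
    rw [hc3, Finsupp.sum, map_sum, Finsupp.finset_sum_apply]
    refine Finset.sum_nonneg fun x hx => ?_
    rw [map_smul, Finsupp.smul_apply]
    exact mul_nonneg (hc2 x) (C.repr_nn (AddSubmonoid.subset_closure (hc1 hx)) a)
  obtain ⟨v, hv0, hv, hvk⟩ := hhw
  have hwts := C.hw_wt hMsimple hv0 hv hvk
  have hθw : hwt H M (e θs) ≠ ⊥ := fun h => hv0 (by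
    rw [h] at hv; exact (Submodule.mem_bot ℂ).1 hv)
  haveI : Nonempty Φ := by
    by_contra hem
    have hem' : Φ = ∅ := Set.not_nonempty_iff_eq_empty.1 (fun h => hem h.to_subtype)
    have h1 := hpos _ hθsmem.2
    rw [hem', AddSubmonoid.closure_empty] at h1
    exact hne0 _ hθΔ (AddSubmonoid.mem_bot.1 h1)
  rw [C.final hMsimple hθsmem.2 hmin hθw hwts]
  have hterm : ∀ a : Φ, Module.finrank ℂ (hwt H M (e a)) = if (a : E) ∈ Δs then 1 else 0 := by
    intro a
    have haΔ := C.ΦΔ a.2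
    split_ifs with h
    · rw [hΔs] at h
      rw [C.short_one hθΔ hmin hhigh (hΦp a.2) (h.2.trans hθn.symm)]
      exact C.hw_one hMsimple hv0 hv hvk
    · have hl : (a : E) ∈ Δl := by
        rw [hcover] at haΔ
        exact haΔ.resolve_left h
      rw [hΔl] at hl
      have hbot : hwt H M (e a) = ⊥ := by
        by_contra hb
        have := C.norm_bound hθΔ hwts hb
        rw [hθn, hl.2] at this
        linarith
      rw [hbot]
      exact finrank_bot ℂ M
  rw [Finset.sum_congr rfl fun a _ => hterm a, Finset.sum_boole, Nat.cast_id]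
  have himg : Φs = ((Finset.univ.filter fun a : Φ => (a : E) ∈ Δs).map
      (Function.Embedding.subtype _) : Finset E) := by
    rw [hΦs]
    ext x
    simp [and_comm]
  rw [himg, Set.ncard_coe_finset, Finset.card_map]
end

section
/- For every short simple root α ∈ Π_s, the number of positive roots γ with (γ|α) > 0 equals ht(θ_s), and the number of positive roots γ with (γ|α) < 0 equals ht(θ_s) − 1. -/
open scoped RealInnerProductSpace

/-- The group generated by the reflections `r_α` for `α ∈ S`. -/
noncomputable def weylOf {E : Type} [NormedAddCommGroup E] [InnerProductSpace ℝ E]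
    [FiniteDimensional ℝ E] (S : Set E) : Subgroup (E ≃ₗᵢ[ℝ] E) :=
  Subgroup.closure (rrefl '' S)

section helpers
variable {E : Type} [NormedAddCommGroup E] [InnerProductSpace ℝ E] [FiniteDimensional ℝ E]

lemma rr_apply (a x : E) : rrefl a x = x - (2 * ⟪x, a⟫ / ⟪a, a⟫) • a := by
  unfold rrefl
  rw [Submodule.reflection_orthogonal_apply, Submodule.reflection_singleton_apply]
  simp only [RCLike.ofReal_real_eq_id, id_eq]
  rw [real_inner_self_eq_norm_sq, real_inner_comm, neg_sub, two_smul, ← add_smul]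
  congr 2
  ring

lemma rr_invol (a x : E) : rrefl a (rrefl a x) = x := by
  unfold rrefl
  exact Submodule.reflection_reflection _ x

lemma rr_inner (a x y : E) : ⟪rrefl a x, y⟫ = ⟪x, rrefl a y⟫ := by
  conv_rhs => rw [← rr_invol a x]
  rw [LinearIsometryEquiv.inner_map_map]

lemma rr_self (a : E) (ha : a ≠ 0) : rrefl a a = -a := by
  rw [rr_apply]
  have : ⟪a, a⟫ ≠ 0 := by simpa using ha
  rw [mul_div_assoc, div_self this, mul_one, two_smul]; abel

open Classical in
lemma M_inv (D : Finset E) (a b : E) (hD : ∀ x ∈ D, rrefl a x ∈ D) :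
    (D.filter fun γ => 0 < ⟪γ, rrefl a b⟫).card = (D.filter fun γ => 0 < ⟪γ, b⟫).card := by
  apply Finset.card_bij' (fun x _ => rrefl a x) (fun x _ => rrefl a x)
  · intro x hx
    rw [Finset.mem_filter] at hx ⊢
    exact ⟨hD x hx.1, by rw [rr_inner]; exact hx.2⟩
  · intro x hx
    rw [Finset.mem_filter] at hx ⊢
    exact ⟨hD x hx.1, by rw [← rr_inner, rr_invol]; exact hx.2⟩
  · intro x _; exact rr_invol a x
  · intro x _; exact rr_invol a x

end helpers

/-- For every short simple root `α ∈ Πs`, the number of positive roots `γ`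
with `(γ|α) > 0` equals `ht θs`, and the number of positive roots `γ` with `(γ|α) < 0` equals
`ht θs − 1`. -/
theorem statement7
    {E : Type} [NormedAddCommGroup E] [InnerProductSpace ℝ E] [FiniteDimensional ℝ E]
    (Δ Δs Δl Δp Φ Φs : Set E)
    -- `Δ` is a finite set of nonzero vectors spanning `E`
    (hfin : Δ.Finite) (h0 : (0 : E) ∉ Δ)
    (hspan : Submodule.span ℝ Δ = ⊤)
    -- stable under all root reflections
    (hrefl : ∀ α ∈ Δ, ∀ β ∈ Δ, rrefl α β ∈ Δ)
    -- crystallographic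
    (hcrys : ∀ α ∈ Δ, ∀ β ∈ Δ, ∃ n : ℤ, 2 * ⟪β, α⟫ / ⟪α, α⟫ = (n : ℝ))
    -- reduced
    (hred : ∀ α ∈ Δ, ∀ t : ℝ, t • α ∈ Δ → t = 1 ∨ t = -1)
    -- irreducible
    (hirr : ∀ A B : Set E, A ∪ B = Δ → (∀ a ∈ A, ∀ b ∈ B, ⟪a, b⟫ = 0) → A = ∅ ∨ B = ∅)
    -- two root lengths: `Δs` are the short roots, `Δl` the long ones
    (ls ll : ℝ) (h0ls : 0 < ls) (hlsll : ls < ll)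
    (hΔs : Δs = {α ∈ Δ | ‖α‖ = ls}) (hΔl : Δl = {α ∈ Δ | ‖α‖ = ll})
    (hcover : Δ = Δs ∪ Δl) (hsne : Δs.Nonempty) (hlne : Δl.Nonempty)
    -- `Δp` is a positive system: for each root exactly one of `±α` is positive
    (hΔpΔ : Δp ⊆ Δ) (hpm : ∀ α ∈ Δ, α ∈ Δp ↔ -α ∉ Δp)
    -- `Φ` is the corresponding set of simple roots, `Φs = Φ ∩ Δs` the short simple roots
    (hΦp : Φ ⊆ Δp)
    (hΦind : LinearIndependent ℝ (fun a : Φ => (a : E)))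
    (hΦdec : ∀ γ ∈ Δp, ∃ c : E →₀ ℕ, ↑c.support ⊆ Φ ∧ γ = c.sum fun α n => (n : ℝ) • α)
    (hΦs : Φs = Φ ∩ Δs)
    -- the height linear functional (heights of roots), `ht α = 1` for simple `α`
    (ht : E →ₗ[ℝ] ℝ) (hht : ∀ α ∈ Φ, ht α = 1)
    -- `θs` is the highest short root
    (θs : E) (hθsmem : θs ∈ Δs ∩ Δp)
    (hθshigh : ∀ γ ∈ Δs, ∃ c : E →₀ ℝ, ↑c.support ⊆ Φ ∧ (∀ α, 0 ≤ c α) ∧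
      θs - γ = c.sum fun α t => t • α)
 :
    ∀ α ∈ Φs,
      ({γ : E | γ ∈ Δp ∧ 0 < ⟪γ, α⟫}.ncard : ℝ) = ht θs ∧
      ({γ : E | γ ∈ Δp ∧ ⟪γ, α⟫ < 0}.ncard : ℝ) = ht θs - 1 := by
  classical
  have hne : ∀ x ∈ Δ, x ≠ 0 := fun x hx h => h0 (h ▸ hx)
  have hneg : ∀ x ∈ Δ, -x ∈ Δ := fun x hx => by
    rw [← rr_self x (hne x hx)]; exact hrefl x hx x hx
  have hΦΔ : Φ ⊆ Δ := hΦp.trans hΔpΔ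
  -- the basis
  have hps : ∀ γ ∈ Δp, γ ∈ Submodule.span ℝ Φ := by
    intro γ hγ
    obtain ⟨c, hc, rfl⟩ := hΦdec γ hγ
    exact Submodule.sum_mem _ fun i hi =>
      Submodule.smul_mem _ _ (Submodule.subset_span (hc hi))
  have hsp : ⊤ ≤ Submodule.span ℝ (Set.range (fun a : Φ => (a : E))) := by
    rw [Subtype.range_coe, ← hspan, Submodule.span_le]
    intro γ hγ
    by_cases h : γ ∈ Δp
    · exact hps γ h
    · have : -γ ∈ Δp := by
        have := (hpm γ hγ); tauto
      have := Submodule.neg_mem _ (hps _ this)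
      simpa using this
  let b : Module.Basis Φ ℝ E := Module.Basis.mk hΦind hsp
  have hb : ∀ j : Φ, b j = (j : E) := fun j => by simp [b]
  have : Fintype Φ := (hfin.subset hΦΔ).fintype
  have hsumn : ∀ (c : E →₀ ℝ), (↑c.support ⊆ Φ) → (∀ x, 0 ≤ c x) →
      ∀ j, 0 ≤ b.coord j (c.sum fun α t => t • α) := by
    intro c hc h j
    rw [Finsupp.sum, map_sum]
    refine Finset.sum_nonneg fun x hx => ?_
    rw [map_smul, smul_eq_mul]
    refine mul_nonneg (h x) ?_
    have : x = b ⟨x, hc hx⟩ := (hb ⟨x, hc hx⟩).symm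
    rw [this, Module.Basis.coord_apply, Module.Basis.repr_self, Finsupp.single_apply]
    split_ifs <;> norm_num
  have hpos : ∀ γ ∈ Δp, ∀ j, 0 ≤ b.coord j γ := by
    intro γ hγ j
    obtain ⟨c, hc, rfl⟩ := hΦdec γ hγ
    rw [Finsupp.sum, map_sum]
    refine Finset.sum_nonneg fun x hx => ?_
    rw [map_smul, smul_eq_mul]
    refine mul_nonneg (Nat.cast_nonneg _) ?_
    have : x = b ⟨x, hc hx⟩ := (hb ⟨x, hc hx⟩).symm
    rw [this, Module.Basis.coord_apply, Module.Basis.repr_self, Finsupp.single_apply]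
    split_ifs <;> norm_num
  -- simple reflections permute the other positive roots
  have hperm : ∀ a ∈ Φ, ∀ γ ∈ Δp, γ ≠ a → rrefl a γ ∈ Δp ∧ rrefl a γ ≠ a := by
    intro a ha γ hγ hγa
    have haΔ := hΦΔ ha
    constructor
    · by_contra hcon
      have h1 : rrefl a γ ∈ Δ := hrefl a haΔ γ (hΔpΔ hγ)
      have h2 : -rrefl a γ ∈ Δp := by
        have := hpm _ h1; tauto
      have h3 : ∀ j : Φ, j ≠ ⟨a, ha⟩ → b.coord j γ = 0 := by
        intro j hj
        have h4 := hpos _ h2 j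
        have h5 := hpos _ hγ j
        have h6 : b.coord j a = 0 := by
          have : a = b ⟨a, ha⟩ := (hb ⟨a, ha⟩).symm
          rw [this, Module.Basis.coord_apply, Module.Basis.repr_self, Finsupp.single_apply,
            if_neg (Ne.symm hj)]
        rw [rr_apply, map_neg, map_sub, map_smul, h6] at h4
        simp only [smul_zero, sub_zero] at h4
        linarith
      have h7 : γ = b.coord ⟨a, ha⟩ γ • a := by
        conv_lhs => rw [← b.sum_repr γ]
        rw [Finset.sum_eq_single ⟨a, ha⟩]
        · rw [hb]; rfl
        · intro j _ hj
          have := h3 j hj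
          rw [Module.Basis.coord_apply] at this
          rw [this, zero_smul]
        · intro h; exact absurd (Finset.mem_univ _) h
      rcases hred a haΔ (b.coord ⟨a, ha⟩ γ) (h7 ▸ hΔpΔ hγ) with h | h
      · rw [h, one_smul] at h7; exact hγa h7
      · have := hpos _ hγ ⟨a, ha⟩
        linarith
    · intro h
      have h1 : γ = -a := by
        have h2 := rr_invol a γ
        rw [h, rr_self a (hne a haΔ)] at h2
        exact h2.symm
      have := (hpm a haΔ).1 (hΦp ha)
      exact this (h1 ▸ hγ)
  -- finsets
  obtain ⟨D, hD⟩ : ∃ D : Finset E, ∀ x, x ∈ D ↔ x ∈ Δ := ⟨hfin.toFinset, by simp⟩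
  obtain ⟨P, hP⟩ : ∃ P : Finset E, ∀ x, x ∈ P ↔ x ∈ Δp := ⟨(hfin.subset hΔpΔ).toFinset, by simp⟩
  -- the height as a sum of coroots
  have hht2 : ∀ x : E, 2 * ht x = ∑ γ ∈ P, 2 * ⟪x, γ⟫ / ⟪γ, γ⟫ := by
    let F : E →ₗ[ℝ] ℝ := ∑ γ ∈ P, (2 / ⟪γ, γ⟫) • (innerₗ E γ)
    have hF : ∀ x, F x = ∑ γ ∈ P, 2 * ⟪x, γ⟫ / ⟪γ, γ⟫ := by
      intro x
      simp only [F, LinearMap.sum_apply, LinearMap.smul_apply, innerₗ_apply_apply, smul_eq_mul]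
      refine Finset.sum_congr rfl fun γ _ => ?_
      rw [real_inner_comm γ x]; ring
    have : (2 : ℝ) • ht = F := by
      apply b.ext
      rintro ⟨a, ha⟩
      rw [hb, LinearMap.smul_apply, hht a ha, hF]
      have haP : a ∈ P := (hP a).2 (hΦp ha)
      have ha0 : ⟪a, a⟫ ≠ 0 := by simpa using hne a (hΦΔ ha)
      rw [← Finset.add_sum_erase _ _ haP, mul_div_assoc, div_self ha0]
      have : ∑ γ ∈ P.erase a, 2 * ⟪a, γ⟫ / ⟪γ, γ⟫ = 0 := by
        have key : ∑ γ ∈ P.erase a, 2 * ⟪a, γ⟫ / ⟪γ, γ⟫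
            = ∑ γ ∈ P.erase a, -(2 * ⟪a, γ⟫ / ⟪γ, γ⟫) := by
          have hm : ∀ x ∈ P.erase a, rrefl a x ∈ P.erase a := by
            intro x hx
            rw [Finset.mem_erase, hP] at hx ⊢
            have := hperm a ha x hx.2 hx.1
            exact ⟨this.2, this.1⟩
          apply Finset.sum_bij' (fun x _ => rrefl a x) (fun x _ => rrefl a x) hm hm
          · intro x _; exact rr_invol a x
          · intro x _; exact rr_invol a x
          · intro x _
            rw [LinearIsometryEquiv.inner_map_map, ← rr_inner,
              rr_self a (hne a (hΦΔ ha)), inner_neg_left]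
            ring
        rw [Finset.sum_neg_distrib] at key
        linarith
      rw [this]; simp
    intro x
    rw [← hF, ← this]; simp
  -- main
  have hθs : θs ∈ Δ ∧ ‖θs‖ = ls := by
    have := hθsmem.1; rw [hΔs] at this; exact this
  intro α hα
  rw [hΦs] at hα
  obtain ⟨hαΦ, hαs⟩ := hα
  have hαΔ := hΦΔ hαΦ
  let M : E → ℕ := fun x => (D.filter fun γ => 0 < ⟪γ, x⟫).card
  have hMα : ‖α‖ = ls := by rw [hΔs] at hαs; exact hαs.2
  obtain ⟨β, hβ, hβmax⟩ := Finset.exists_max_image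
    (D.filter fun β => ‖β‖ = ls ∧ M β = M α) ht
    ⟨α, by rw [Finset.mem_filter, hD]; exact ⟨hαΔ, hMα, rfl⟩⟩
  rw [Finset.mem_filter, hD] at hβ
  obtain ⟨hβΔ, hβn, hβM⟩ := hβ
  have hdom : ∀ a ∈ Φ, 0 ≤ ⟪β, a⟫ := by
    intro a ha
    have haΔ := hΦΔ ha
    have h1 := hβmax (rrefl a β) (by
      rw [Finset.mem_filter, hD]
      refine ⟨hrefl a haΔ β hβΔ, by rw [LinearIsometryEquiv.norm_map, hβn], ?_⟩
      rw [← hβM]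
      exact M_inv D a β (fun x hx => (hD _).2 (hrefl a haΔ x ((hD x).1 hx))))
    rw [rr_apply, map_sub, map_smul, hht a ha, smul_eq_mul, mul_one] at h1
    have h2 : 0 < ⟪a, a⟫ := real_inner_self_pos.2 (hne a haΔ)
    have h3 : 0 ≤ 2 * ⟪β, a⟫ / ⟪a, a⟫ := by linarith
    have h4 := mul_nonneg h3 h2.le
    rw [div_mul_cancel₀ _ h2.ne'] at h4
    linarith
  have hdom' : ∀ x : E, (∀ j, 0 ≤ b.coord j x) → 0 ≤ ⟪β, x⟫ := by
    intro x hx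
    rw [← b.sum_repr x, inner_sum]
    refine Finset.sum_nonneg fun j _ => ?_
    rw [inner_smul_right, hb]
    exact mul_nonneg (hx j) (hdom _ j.2)
  have heq : ∀ x y : E, ‖x‖ = ‖y‖ → ‖x‖ * ‖x‖ ≤ ⟪x, y⟫ → x = y := by
    intro x y h1 h2
    have h3 : ‖x - y‖ ^ 2 ≤ 0 := by
      rw [norm_sub_sq_real, ← h1]; nlinarith
    have h4 : ‖x - y‖ = 0 := by nlinarith [norm_nonneg (x - y)]
    exact sub_eq_zero.1 (norm_eq_zero.1 h4)
  have hβθ : β = θs := by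
    apply heq _ _ (by rw [hβn, hθs.2])
    obtain ⟨c, hc, hc0, hcs⟩ := hθshigh β (by rw [hΔs]; exact ⟨hβΔ, hβn⟩)
    have := hdom' (θs - β) (by rw [hcs]; exact hsumn c hc hc0)
    rw [inner_sub_right, real_inner_self_eq_norm_mul_norm] at this
    linarith
  rw [hβθ] at hdom' hβM
  -- count for θ
  have hge : ∀ γ ∈ Δ, ls ≤ ‖γ‖ := by
    intro γ hγ
    rw [hcover, hΔs, hΔl] at hγ
    rcases hγ with h | h
    · exact h.2.ge
    · rw [h.2]; exact hlsll.le
  have hMθ : M θs = (P.filter fun γ => 0 < ⟪γ, θs⟫).card := by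
    show (D.filter fun γ => 0 < ⟪γ, θs⟫).card = _
    congr 1
    ext γ
    simp only [Finset.mem_filter, hD, hP]
    constructor
    · rintro ⟨h1, h2⟩
      refine ⟨?_, h2⟩
      by_contra h3
      have h4 : -γ ∈ Δp := by have := hpm γ h1; tauto
      have := hdom' _ (hpos _ h4)
      rw [inner_neg_right, real_inner_comm] at this
      linarith
    · rintro ⟨h1, h2⟩
      exact ⟨hΔpΔ h1, h2⟩
  have hθP : θs ∈ P := (hP _).2 hθsmem.2
  have hval : ∀ γ ∈ P, 2 * ⟪θs, γ⟫ / ⟪γ, γ⟫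
      = (if 0 < ⟪γ, θs⟫ then 1 else 0) + (if γ = θs then 1 else 0) := by
    intro γ hγ
    rw [hP] at hγ
    have hγΔ := hΔpΔ hγ
    have hg : 0 < ⟪γ, γ⟫ := real_inner_self_pos.2 (hne γ hγΔ)
    have hnn : 0 ≤ ⟪θs, γ⟫ := hdom' _ (hpos _ hγ)
    by_cases h1 : γ = θs
    · rw [← h1, mul_div_assoc, div_self hg.ne', if_pos hg, if_pos rfl]; norm_num
    · rw [if_neg h1, add_zero]
      by_cases h2 : 0 < ⟪γ, θs⟫
      · rw [if_pos h2]
        obtain ⟨n, hn⟩ := hcrys γ hγΔ θs hθs.1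
        rw [hn]
        rw [real_inner_comm] at h2
        have h3 : (0 : ℝ) < n := by rw [← hn]; positivity
        have h3' : 0 < n := by exact_mod_cast h3
        have h4 : n < 2 := by
          by_contra h4
          push Not at h4
          have h5 : (2 : ℝ) ≤ n := by exact_mod_cast h4
          rw [← hn, le_div_iff₀ hg, real_inner_self_eq_norm_mul_norm] at h5
          have h6 := real_inner_le_norm θs γ
          have h7 := hge γ hγΔ
          rw [hθs.2] at h6
          have h8 : ‖γ‖ ≤ ls := by
            by_contra h9
            push Not at h9
            nlinarith
          have h9 : ‖γ‖ = ls := le_antisymm h8 h7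
          apply h1
          apply heq _ _ (by rw [h9, hθs.2])
          rw [real_inner_comm]
          linarith
        have : n = 1 := by omega
        rw [this]; norm_num
      · rw [if_neg h2]
        rw [real_inner_comm] at h2
        have : ⟪θs, γ⟫ = 0 := by linarith
        rw [this]; simp
  have hfinal : 2 * ht θs = (M α : ℝ) + 1 := by
    rw [hht2, Finset.sum_congr rfl hval, Finset.sum_add_distrib, Finset.sum_ite_eq' P θs,
      if_pos hθP, ← hβM, hMθ, Finset.sum_boole]
  -- counts for α
  have e1 : {γ : E | γ ∈ Δp ∧ 0 < ⟪γ, α⟫}.ncard = (P.filter fun γ => 0 < ⟪γ, α⟫).card := by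
    rw [← Set.ncard_coe_finset]; congr 1; ext γ; simp [hP]
  have e2 : {γ : E | γ ∈ Δp ∧ ⟪γ, α⟫ < 0}.ncard = (P.filter fun γ => ⟪γ, α⟫ < 0).card := by
    rw [← Set.ncard_coe_finset]; congr 1; ext γ; simp [hP]
  have hαα : 0 < ⟪α, α⟫ := real_inner_self_pos.2 (hne α hαΔ)
  have e3 : (P.filter fun γ => 0 < ⟪γ, α⟫).card = (P.filter fun γ => ⟪γ, α⟫ < 0).card + 1 := by
    have hmem : α ∈ P.filter fun γ => 0 < ⟪γ, α⟫ :=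
      Finset.mem_filter.2 ⟨(hP _).2 (hΦp hαΦ), hαα⟩
    rw [← Finset.card_erase_add_one hmem]
    congr 1
    have hin : ∀ x, ⟪rrefl α x, α⟫ = -⟪x, α⟫ := by
      intro x
      rw [rr_inner, rr_self α (hne α hαΔ), inner_neg_right]
    apply Finset.card_bij' (fun x _ => rrefl α x) (fun x _ => rrefl α x)
    · intro x hx
      rw [Finset.mem_erase, Finset.mem_filter, hP] at hx
      rw [Finset.mem_filter, hP, hin]
      exact ⟨(hperm α hαΦ x hx.2.1 hx.1).1, by linarith [hx.2.2]⟩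
    · intro x hx
      rw [Finset.mem_filter, hP] at hx
      have hxa : x ≠ α := by rintro rfl; linarith [hx.2]
      rw [Finset.mem_erase, Finset.mem_filter, hP, hin]
      have := hperm α hαΦ x hx.1 hxa
      exact ⟨this.2, this.1, by linarith [hx.2]⟩
    · intro x _; exact rr_invol α x
    · intro x _; exact rr_invol α x
  have e4 : M α = (P.filter fun γ => 0 < ⟪γ, α⟫).card + (P.filter fun γ => ⟪γ, α⟫ < 0).card := by
    show (D.filter fun γ => 0 < ⟪γ, α⟫).card = _
    rw [← Finset.card_filter_add_card_filter_not (s := D.filter fun γ => 0 < ⟪γ, α⟫) (· ∈ P)]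
    congr 1
    · congr 1
      ext γ
      simp only [Finset.mem_filter, hD, hP]
      have := @hΔpΔ γ
      tauto
    · refine Finset.card_bij' (fun x _ => -x) (fun x _ => -x) ?_ ?_ ?_ ?_
      · intro x hx
        simp only [Finset.mem_filter, hD, hP] at hx ⊢
        have := hpm x hx.1.1
        rw [inner_neg_left]
        exact ⟨by tauto, by linarith [hx.1.2]⟩
      · intro x hx
        simp only [Finset.mem_filter, hD, hP] at hx ⊢
        have := hpm x (hΔpΔ hx.1)
        rw [inner_neg_left]
        exact ⟨⟨hneg x (hΔpΔ hx.1), by linarith [hx.2]⟩, this.1 hx.1⟩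
      · intro x _; exact neg_neg x
      · intro x _; exact neg_neg x
  rw [e1, e2]
  have e3' : ((P.filter fun γ => 0 < ⟪γ, α⟫).card : ℝ) = (P.filter fun γ => ⟪γ, α⟫ < 0).card + 1 := by
    exact_mod_cast e3
  have e4' : (M α : ℝ) = (P.filter fun γ => 0 < ⟪γ, α⟫).card + (P.filter fun γ => ⟪γ, α⟫ < 0).card := by
    exact_mod_cast e4
  constructor <;> linarith
end

section
/- For a positive root γ, the difference θ_s − γ is a short root or zero if and only if (γ|θ_s) > 0; consequently #{γ ∈ Δ⁺ : θ_s − γ ∈ Δ_s ∪ {0}} = 2·ht(θ_s) − 1. -/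
open scoped RealInnerProductSpace

theorem rrefl_formula {E : Type} [NormedAddCommGroup E] [InnerProductSpace ℝ E]
    [FiniteDimensional ℝ E] (α x : E) :
    rrefl α x = x - (2 * ⟪x, α⟫ / ⟪α, α⟫) • α := by
  unfold rrefl
  rw [Submodule.reflection_orthogonal_apply, Submodule.reflection_singleton_apply]
  have h : ((‖α‖ : ℝ) : ℝ) ^ 2 = ⟪α, α⟫ := (real_inner_self_eq_norm_sq α).symm
  simp only [RCLike.ofReal_real_eq_id, id]
  rw [real_inner_comm x α, h, neg_sub, two_smul, ← add_smul]
  congr 2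
  ring

/-- For a positive root `γ`, the difference `θs − γ` is a short root or zero
iff `(γ|θs) > 0`; consequently `#{γ ∈ Δ⁺ : θs − γ ∈ Δs ∪ {0}} = 2·ht(θs) − 1`. -/
theorem statement8
    {E : Type} [NormedAddCommGroup E] [InnerProductSpace ℝ E] [FiniteDimensional ℝ E]
    (Δ Δs Δl Δp Φ Φs : Set E)
    -- `Δ` is a finite set of nonzero vectors spanning `E`
    (hfin : Δ.Finite) (h0 : (0 : E) ∉ Δ)
    (hspan : Submodule.span ℝ Δ = ⊤)
    -- stable under all root reflections
    (hrefl : ∀ α ∈ Δ, ∀ β ∈ Δ, rrefl α β ∈ Δ)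
    -- crystallographic
    (hcrys : ∀ α ∈ Δ, ∀ β ∈ Δ, ∃ n : ℤ, 2 * ⟪β, α⟫ / ⟪α, α⟫ = (n : ℝ))
    -- reduced
    (hred : ∀ α ∈ Δ, ∀ t : ℝ, t • α ∈ Δ → t = 1 ∨ t = -1)
    -- irreducible
    (hirr : ∀ A B : Set E, A ∪ B = Δ → (∀ a ∈ A, ∀ b ∈ B, ⟪a, b⟫ = 0) → A = ∅ ∨ B = ∅)
    -- two root lengths: `Δs` are the short roots, `Δl` the long ones
    (ls ll : ℝ) (h0ls : 0 < ls) (hlsll : ls < ll)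
    (hΔs : Δs = {α ∈ Δ | ‖α‖ = ls}) (hΔl : Δl = {α ∈ Δ | ‖α‖ = ll})
    (hcover : Δ = Δs ∪ Δl) (hsne : Δs.Nonempty) (hlne : Δl.Nonempty)
    -- `Δp` is a positive system: for each root exactly one of `±α` is positive
    (hΔpΔ : Δp ⊆ Δ) (hpm : ∀ α ∈ Δ, α ∈ Δp ↔ -α ∉ Δp)
    -- `Φ` is the corresponding set of simple roots, `Φs = Φ ∩ Δs` the short simple roots
    (hΦp : Φ ⊆ Δp)
    (hΦind : LinearIndependent ℝ (fun a : Φ => (a : E)))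
    (hΦdec : ∀ γ ∈ Δp, ∃ c : E →₀ ℕ, ↑c.support ⊆ Φ ∧ γ = c.sum fun α n => (n : ℝ) • α)
    (hΦs : Φs = Φ ∩ Δs)
    -- the height linear functional (heights of roots), `ht α = 1` for simple `α`
    (ht : E →ₗ[ℝ] ℝ) (hht : ∀ α ∈ Φ, ht α = 1)
    -- `θs` is the highest short root
    (θs : E) (hθsmem : θs ∈ Δs ∩ Δp)
    (hθshigh : ∀ γ ∈ Δs, ∃ c : E →₀ ℝ, ↑c.support ⊆ Φ ∧ (∀ α, 0 ≤ c α) ∧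
      θs - γ = c.sum fun α t => t • α)
 :
    (∀ γ ∈ Δp, (θs - γ ∈ Δs ∪ {0}) ↔ 0 < ⟪γ, θs⟫) ∧
    ({γ : E | γ ∈ Δp ∧ θs - γ ∈ Δs ∪ {0}}.ncard : ℝ) = 2 * ht θs - 1 := by
  have hpos : ∀ γ ∈ Δ, 0 < ⟪γ, γ⟫ := fun γ hγ => by
    rw [real_inner_self_eq_norm_sq]
    have : γ ≠ 0 := fun h => h0 (h ▸ hγ)
    positivity
  have hθΔ : θs ∈ Δ := hΔpΔ hθsmem.2
  have hθn : ‖θs‖ = ls := by have := hθsmem.1; rw [hΔs] at this; exact this.2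
  have hlen : ∀ γ ∈ Δ, ls ≤ ‖γ‖ := fun γ hγ => by
    rw [hcover, hΔs, hΔl] at hγ
    rcases hγ with h | h
    · exact h.2.ge
    · rw [h.2]; exact hlsll.le
  have hnorm : ∀ α x : E, ‖rrefl α x‖ = ‖x‖ := fun α x => (rrefl α).norm_map x
  -- the pairing takes the value one
  have hone : ∀ γ ∈ Δ, 0 < ⟪γ, θs⟫ → γ ≠ θs → 2 * ⟪θs, γ⟫ / ⟪γ, γ⟫ = 1 := by
    intro γ hγ hp hne
    obtain ⟨n, hn⟩ := hcrys γ hγ θs hθΔ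
    have hg := hpos γ hγ
    rw [real_inner_comm] at hp
    have hn0 : (0 : ℝ) < n := by rw [← hn]; positivity
    have hn1 : 0 < n := by exact_mod_cast hn0
    have hn2 : n < 2 := by
      by_contra hc
      have hc' : (2 : ℝ) ≤ n := by exact_mod_cast not_lt.mp hc
      rw [← hn, le_div_iff₀ hg] at hc'
      have h1 := norm_sub_sq_real θs γ
      rw [real_inner_self_eq_norm_sq] at hc'
      have h2 := hlen γ hγ
      have h3 : ‖θs - γ‖ ^ 2 ≤ 0 := by rw [h1, hθn]; nlinarith
      have h4 : ‖θs - γ‖ = 0 := by nlinarith [norm_nonneg (θs - γ)]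
      exact hne (sub_eq_zero.mp (norm_eq_zero.mp h4)).symm
    have : n = 1 := by omega
    rw [hn, this]; simp
  have hiff : ∀ γ ∈ Δp, (θs - γ ∈ Δs ∪ {0}) ↔ 0 < ⟪γ, θs⟫ := by
    intro γ hγp
    have hγ := hΔpΔ hγp
    have hg := hpos γ hγ
    constructor
    · rintro (h | h)
      · rw [hΔs] at h
        have h1 := norm_sub_sq_real θs γ
        rw [h.2, hθn, ← real_inner_self_eq_norm_sq γ] at h1
        rw [real_inner_comm]
        linarith
      · have : θs = γ := sub_eq_zero.mp h
        rw [this]; exact hg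
    · intro h
      by_cases hne : γ = θs
      · right; simp [hne]
      · left
        have h1 := rrefl_formula γ θs
        rw [hone γ hγ h hne, one_smul] at h1
        rw [← h1, hΔs]
        exact ⟨hrefl γ hγ θs hθΔ, by rw [hnorm, hθn]⟩
  refine ⟨hiff, ?_⟩
  -- heights of positive roots
  have hhtpos : ∀ γ ∈ Δp, 0 < ht γ := by
    intro γ hγ
    obtain ⟨c, hc, hs⟩ := hΦdec γ hγ
    have hγ0 : γ ≠ 0 := fun h => h0 (h ▸ hΔpΔ hγ)
    have hc0 : c ≠ 0 := by rintro rfl; simp at hs; exact hγ0 hs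
    rw [hs, Finsupp.sum, map_sum]
    apply Finset.sum_pos
    · intro i hi
      rw [map_smul, hht i (hc hi)]
      have : 0 < c i := Nat.pos_of_ne_zero (Finsupp.mem_support_iff.mp hi)
      simp [this]
    · exact Finsupp.support_nonempty_iff.mpr hc0
  -- dominance
  have hdom : ∀ γ ∈ Δp, 0 ≤ ⟪θs, γ⟫ := by
    intro γ hγp
    have hγ := hΔpΔ hγp
    have hg := hpos γ hγ
    by_contra hlt
    push Not at hlt
    have h1 := rrefl_formula γ θs
    have h2 : rrefl γ θs ∈ Δs := by
      rw [hΔs]; exact ⟨hrefl γ hγ θs hθΔ, by rw [hnorm, hθn]⟩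
    obtain ⟨c, hc, hcn, hs⟩ := hθshigh _ h2
    have h3 : 0 ≤ ht (θs - rrefl γ θs) := by
      rw [hs, Finsupp.sum, map_sum]
      apply Finset.sum_nonneg
      intro i hi
      rw [map_smul, hht i (hc hi)]
      simpa using hcn i
    rw [h1, sub_sub_cancel, map_smul, smul_eq_mul] at h3
    have h4 : 2 * ⟪θs, γ⟫ / ⟪γ, γ⟫ < 0 := div_neg_of_neg_of_pos (by linarith) hg
    nlinarith [hhtpos γ hγp]
  -- simple reflections permute the other positive roots
  have hperm : ∀ α ∈ Φ, ∀ γ ∈ Δp, γ ≠ α → rrefl α γ ∈ Δp := by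
    intro α hα γ hγp hne
    have hγ := hΔpΔ hγp
    have hαΔ := hΔpΔ (hΦp hα)
    by_contra hnot
    have h1 : -rrefl α γ ∈ Δp := by
      by_contra h; exact hnot ((hpm _ (hrefl α hαΔ γ hγ)).2 h)
    obtain ⟨c, hc, hcs⟩ := hΦdec γ hγp
    obtain ⟨d, hd, hds⟩ := hΦdec _ h1
    set t := 2 * ⟪γ, α⟫ / ⟪α, α⟫ with ht'
    have hform := rrefl_formula α γ
    have key : ∀ e : E →₀ ℕ, ↑e.support ⊆ Φ →
        e.mapRange (Nat.cast : ℕ → ℝ) Nat.cast_zero ∈ Finsupp.supported ℝ ℝ Φ := by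
      intro e he
      rw [Finsupp.mem_supported]
      exact subset_trans (Finset.coe_subset.mpr Finsupp.support_mapRange) he
    have key2 : ∀ e : E →₀ ℕ, Finsupp.linearCombination ℝ (id : E → E)
        (e.mapRange (Nat.cast : ℕ → ℝ) Nat.cast_zero) = e.sum fun α n => (n : ℝ) • α := by
      intro e
      rw [Finsupp.linearCombination_apply, Finsupp.sum_mapRange_index (by simp)]
      rfl
    have hind : LinearIndepOn ℝ (id : E → E) Φ := hΦind
    rw [linearIndepOn_iff] at hind
    have h2 := hind (c.mapRange (Nat.cast : ℕ → ℝ) Nat.cast_zero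
      + d.mapRange (Nat.cast : ℕ → ℝ) Nat.cast_zero - Finsupp.single α t)
      (Submodule.sub_mem _ (Submodule.add_mem _ (key c hc) (key d hd))
        (Finsupp.single_mem_supported ℝ t hα))
      (by
        rw [map_sub, map_add, key2, key2, ← hcs, ← hds, hform, ← ht',
          Finsupp.linearCombination_single, id]
        abel)
    have h3 : ∀ β, β ≠ α → c β = 0 := by
      intro β hβ
      have := DFunLike.congr_fun h2 β
      simp [Finsupp.single_apply, hβ.symm] at this
      have h5 : c β + d β = 0 := by exact_mod_cast this
      omega
    have h4 : c = Finsupp.single α (c α) := by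
      ext β
      by_cases hβ : β = α
      · subst hβ; simp
      · rw [h3 β hβ]; simp [Finsupp.single_apply, Ne.symm hβ]
    have h5 : γ = (c α : ℝ) • α := by
      rw [hcs]
      conv_lhs => rw [h4]
      rw [Finsupp.sum_single_index (by simp)]
    rcases hred α hαΔ (c α) (h5 ▸ hγ) with h | h
    · rw [h, one_smul] at h5; exact hne h5
    · have : (0 : ℝ) ≤ c α := Nat.cast_nonneg _
      linarith
  have hpfin : Δp.Finite := hfin.subset hΔpΔ
  classical
  set P := hpfin.toFinset with hP
  have hPm : ∀ γ, γ ∈ P ↔ γ ∈ Δp := fun γ => by simp [hP]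
  -- the sum of positive coroots as a functional
  let S : E →ₗ[ℝ] ℝ := ∑ γ ∈ P, (2 / ⟪γ, γ⟫) • (innerₗ E γ)
  have hS : ∀ x, S x = ∑ γ ∈ P, 2 * ⟪x, γ⟫ / ⟪γ, γ⟫ := by
    intro x
    simp only [S, LinearMap.sum_apply, LinearMap.smul_apply, innerₗ_apply_apply, smul_eq_mul]
    refine Finset.sum_congr rfl fun γ _ => ?_
    rw [real_inner_comm x γ]; ring
  have hSsimple : ∀ α ∈ Φ, S α = 2 := by
    intro α hα
    have hαp := hΦp hα
    have hαΔ := hΔpΔ hαp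
    have ha := hpos α hαΔ
    rw [hS, ← Finset.add_sum_erase _ _ ((hPm α).2 hαp)]
    have hself : rrefl α α = -α := by
      rw [rrefl_formula, mul_div_assoc, div_self ha.ne', mul_one, two_smul]; abel
    have hinv : ∀ x, rrefl α (rrefl α x) = x := fun x => by
      unfold rrefl; exact Submodule.reflection_reflection _ x
    have hneg : ∀ γ, 2 * ⟪α, rrefl α γ⟫ / ⟪rrefl α γ, rrefl α γ⟫
        = - (2 * ⟪α, γ⟫ / ⟪γ, γ⟫) := by
      intro γ
      have h1 : ⟪rrefl α (-α), rrefl α γ⟫ = ⟪-α, γ⟫ := (rrefl α).inner_map_map _ _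
      rw [map_neg, hself, neg_neg, inner_neg_left] at h1
      have h2 : ⟪rrefl α γ, rrefl α γ⟫ = ⟪γ, γ⟫ := (rrefl α).inner_map_map _ _
      rw [h1, h2]; ring
    have hz : ∑ γ ∈ P.erase α, 2 * ⟪α, γ⟫ / ⟪γ, γ⟫ = 0 := by
      refine Finset.sum_involution (fun γ _ => rrefl α γ) ?_ ?_ ?_ ?_
      · intro γ _; rw [hneg]; ring
      · intro γ _ hne heq
        have := hneg γ
        rw [heq] at this
        apply hne; linarith
      · intro γ hγ
        rw [Finset.mem_erase, hPm] at hγ ⊢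
        refine ⟨fun h => ?_, hperm α hα γ hγ.2 hγ.1⟩
        have h1 := hinv γ
        rw [h, hself] at h1
        exact (hpm α hαΔ).1 hαp (h1 ▸ hγ.2)
      · intro γ _; exact hinv γ
    rw [hz, mul_div_assoc, div_self ha.ne']; norm_num
  have hSθ : S θs = 2 * ht θs := by
    obtain ⟨c, hc, hs⟩ := hΦdec θs hθsmem.2
    rw [hs, Finsupp.sum, map_sum, map_sum, Finset.mul_sum]
    refine Finset.sum_congr rfl fun i hi => ?_
    rw [map_smul, map_smul, hSsimple i (hc hi), hht i (hc hi)]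
    simp [mul_comm]
  have hset : {γ : E | γ ∈ Δp ∧ θs - γ ∈ Δs ∪ {0}}
      = ((P.filter fun γ => 0 < ⟪γ, θs⟫ : Finset E) : Set E) := by
    ext γ
    simp only [Set.mem_setOf_eq, Finset.coe_filter, hPm]
    exact and_congr_right fun h => hiff γ h
  rw [hset, Set.ncard_coe_finset, ← hSθ, hS, Finset.card_filter]
  push_cast
  have hθP : θs ∈ P := (hPm θs).2 hθsmem.2
  have hθθ := hpos θs hθΔ
  rw [← Finset.add_sum_erase _ _ hθP, ← Finset.add_sum_erase P (fun γ => 2 * ⟪θs, γ⟫ / ⟪γ, γ⟫) hθP]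
  have hsum : ∑ γ ∈ P.erase θs, (if 0 < ⟪γ, θs⟫ then (1 : ℝ) else 0)
      = ∑ γ ∈ P.erase θs, 2 * ⟪θs, γ⟫ / ⟪γ, γ⟫ := by
    refine Finset.sum_congr rfl fun γ hγ => ?_
    rw [Finset.mem_erase, hPm] at hγ
    split_ifs with h
    · exact (hone γ (hΔpΔ hγ.2) h hγ.1).symm
    · have h1 := hdom γ hγ.2
      rw [real_inner_comm] at h
      have : ⟪θs, γ⟫ = 0 := le_antisymm (not_lt.mp h) h1
      rw [this]; simp
  rw [hsum, if_pos hθθ, mul_div_assoc, div_self hθθ.ne']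
  ring
end

section
/- Let 𝔥 = 𝔱 ⊕ (⊕_{μ∈Δ_l} 𝔤^μ) be the subalgebra of 𝔤 spanned by the Cartan subalgebra and all long root spaces. Then the zero weight space of the little adjoint module equals the set of vectors annihilated by 𝔥: V_{θ_s}^0 = {v ∈ V_{θ_s} : x·v = 0 for all x ∈ 𝔥}. -/
open scoped RealInnerProductSpace

section helpers
open LieAlgebra LieModule

variable {L : Type} [LieRing L] [LieAlgebra ℂ L] (H : LieSubalgebra ℂ L)
  (M : Type) [AddCommGroup M] [Module ℂ M] [LieRingModule L M] [LieModule ℂ L M]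

lemma hlp_mem (χ : H → ℂ) (v : M) : v ∈ hwt H M χ ↔ ∀ x : H, ⁅(x : L), v⁆ = χ x • v := Iff.rfl

lemma hlp_lie {χ ψ : H → ℂ} {y : L} {v : M} (hy : y ∈ hwt H L ψ) (hv : v ∈ hwt H M χ) :
    ⁅y, v⁆ ∈ hwt H M (χ + ψ) := by
  intro x
  rw [leibniz_lie, hy x, hv x, smul_lie, lie_smul, Pi.add_apply, add_smul, add_comm]

lemma hlp_pow {χ ψ : H → ℂ} {y : L} {v : M} (hy : y ∈ hwt H L ψ) (hv : v ∈ hwt H M χ) (n : ℕ) :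
    ((toEnd ℂ L M y) ^ n) v ∈ hwt H M (χ + n • ψ) := by
  induction n with
  | zero => simpa using hv
  | succ n ih =>
    rw [pow_succ', Module.End.mul_apply, toEnd_apply_apply, succ_nsmul, ← add_assoc]
    exact hlp_lie H M hy ih

lemma hlp_le [LieRing.IsNilpotent H] (χ : H → ℂ) :
    hwt H M χ ≤ (genWeightSpace M χ).toSubmodule := by
  intro v hv
  apply weightSpace_le_genWeightSpace M χ
  rw [mem_weightSpace]
  intro x
  exact hv x

lemma hlp_ind [LieRing.IsNilpotent H] : iSupIndep (fun χ : H → ℂ => hwt H M χ) := by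
  have h := iSupIndep_genWeightSpace ℂ H M
  rw [← LieSubmodule.iSupIndep_toSubmodule] at h
  exact h.mono (fun χ => hlp_le H M χ)

lemma hlp_fin [LieRing.IsNilpotent H] [FiniteDimensional ℂ M] :
    {χ : H → ℂ | hwt H M χ ≠ ⊥}.Finite :=
  WellFoundedGT.finite_ne_bot_of_iSupIndep (hlp_ind H M)

lemma hlp_str [LieRing.IsNilpotent H] [FiniteDimensional ℂ M] {a : H → ℂ} {h : H} {x y : L}
    (t : IsSl2Triple (h : L) x y) (hx : x ∈ hwt H L a) (hy : y ∈ hwt H L (-a))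
    (χ : H → ℂ) (hχ : hwt H M χ ≠ ⊥) :
    ∃ k : ℤ, χ h = k ∧ (k ≤ 0 → hwt H M (χ - k • a) ≠ ⊥) := by
  obtain ⟨w, hw, hw0⟩ := (Submodule.ne_bot_iff _).1 hχ
  have ha : a h = 2 := by
    have h1 := hx h
    rw [t.lie_h_e_smul ℂ] at h1
    exact (smul_left_injective ℂ t.e_ne_zero h1).symm
  have hex : ∃ n : ℕ, ((toEnd ℂ L M y) ^ n) w = 0 := by
    by_contra! hc
    have := hlp_fin H M
    refine Set.infinite_of_injective_forall_mem (f := fun n : ℕ => χ + n • (-a)) ?_ ?_ this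
    · intro n m hnm
      have := congrFun hnm h
      simpa [ha] using this
    · intro n
      exact (Submodule.ne_bot_iff _).2 ⟨_, hlp_pow H M hy hw n, hc n⟩
  obtain ⟨i, hi1, hi2⟩ := Nat.exists_not_and_succ_of_not_zero_of_exists (by simpa using hw0) hex
  have hu := hlp_pow H M hy hw i
  set u := ((toEnd ℂ L M y) ^ i) w
  have P : t.symm.HasPrimitiveVectorWith u (-(χ h - 2 * i)) := by
    refine ⟨hi1, ?_, ?_⟩
    · rw [neg_lie, hu h, ← neg_smul]
      congr 1
      simp [ha]; ring
    · rw [pow_succ', Module.End.mul_apply, toEnd_apply_apply] at hi2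
      exact hi2
  obtain ⟨n, hn⟩ := P.exists_nat
  refine ⟨2 * i - n, ?_, ?_⟩
  · push_cast
    linear_combination -hn
  · intro hk
    have hin : i ≤ n := by omega
    obtain ⟨m, rfl⟩ := Nat.exists_eq_add_of_le hin
    have h1 := P.pow_toEnd_f_ne_zero_of_eq_nat hn (i := m) (by omega)
    refine (Submodule.ne_bot_iff _).2 ⟨_, ?_, h1⟩
    have h2 := hlp_pow H M hx hu m
    convert h2 using 2
    ext z
    simp
    ring

lemma hlp_str' [LieRing.IsNilpotent H] [FiniteDimensional ℂ M] {a : H → ℂ} {h : H} {x y : L}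
    (t : IsSl2Triple (h : L) x y) (hx : x ∈ hwt H L a) (hy : y ∈ hwt H L (-a))
    (χ : H → ℂ) (hχ : hwt H M χ ≠ ⊥) :
    ∃ k : ℤ, χ h = k ∧ hwt H M (χ - k • a) ≠ ⊥ := by
  obtain ⟨k, hk, hk'⟩ := hlp_str H M t hx hy χ hχ
  refine ⟨k, hk, ?_⟩
  obtain h0 | h0 := le_total k 0
  · exact hk' h0
  have hneg : χ (-h) = -χ h := by
    obtain ⟨w, hw, hw0⟩ := (Submodule.ne_bot_iff _).1 hχ
    have h1 := hw (-h)
    have h2 := hw h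
    rw [H.coe_neg, neg_lie, h2, ← neg_smul] at h1
    exact (smul_left_injective ℂ hw0 h1).symm
  have t' : IsSl2Triple ((-h : H) : L) y x := by simpa using t.symm
  obtain ⟨k2, hk2, hk2'⟩ := hlp_str H M t' hy (by simpa using hx) χ hχ
  have : k2 = -k := by
    rw [hneg, hk] at hk2
    exact_mod_cast hk2.symm
  subst this
  simpa using hk2' (by omega)

variable [FiniteDimensional ℂ L] [IsKilling ℂ L] [H.IsCartanSubalgebra]

lemma hlp_root (χ : H → ℂ) : hwt H L χ = (rootSpace H χ).toSubmodule := by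
  apply le_antisymm (hlp_le H L χ)
  intro v hv x
  exact IsKilling.lie_eq_smul_of_mem_rootSpace hv x

lemma hlp_top : (⨆ χ : H → ℂ, hwt H L χ) = ⊤ := by
  have := iSup_genWeightSpace_eq_top ℂ H L
  simp only [← LieSubmodule.toSubmodule_inj, LieSubmodule.iSup_toSubmodule,
    LieSubmodule.top_toSubmodule] at this
  rw [← this]
  exact iSup_congr fun χ => hlp_root H χ

lemma hlp_zero {y : L} (hy : y ∈ hwt H L (0 : H → ℂ)) : y ∈ H := by
  rw [hlp_root, rootSpace_zero_eq] at hy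
  simpa using hy

lemma hlp_sl2 (a : H → ℂ) (ha : a ≠ 0) (h : hwt H L a ≠ ⊥) :
    ∃ (h : H) (x y : L), IsSl2Triple (h : L) x y ∧ x ∈ hwt H L a ∧ y ∈ hwt H L (-a) := by
  have h' : rootSpace H a ≠ ⊥ := by
    rw [hlp_root] at h
    simpa using h
  let α : Weight ℂ H L := ⟨a, h'⟩
  have hα : α.IsNonZero := ha
  obtain ⟨h, x, y, t, hx, hy⟩ := IsKilling.exists_isSl2Triple_of_weight_isNonZero hα
  have hx' : x ∈ hwt H L a := by rw [hlp_root]; exact hx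
  have hy' : y ∈ hwt H L (-a) := by rw [hlp_root]; exact hy
  have hh : h ∈ H := by
    apply hlp_zero H
    rw [← t.lie_e_f]
    simpa using hlp_lie H L hx' hy'
  exact ⟨⟨h, hh⟩, x, y, t, hx', hy'⟩

lemma hlp_hw {E : Type} [AddCommGroup E] (e : E →+ (H → ℂ)) (Δ Δp : Set E) (θ : E)
    (hroots2 : ∀ χ : H → ℂ, χ ≠ 0 → hwt H L χ ≠ ⊥ → ∃ μ ∈ Δ, χ = e μ)
    (hpm : ∀ μ ∈ Δ, μ ∈ Δp ∨ -μ ∈ Δp)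
    (hMsimple : ∀ N : LieSubmodule ℂ L M, N = ⊥ ∨ N = ⊤)
    (v : M) (hv0 : v ≠ 0) (hv : v ∈ hwt H M (e θ))
    (hvp : ∀ γ ∈ Δp, ∀ x ∈ hwt H L (e γ), ⁅x, v⁆ = 0)
    (χ : H → ℂ) (hχ : hwt H M χ ≠ ⊥) :
    ∃ c ∈ AddSubmonoid.closure Δp, χ = e (θ - c) := by
  let S : Set (Submodule ℂ M) :=
    {N | v ∈ N ∧ ∀ γ ∈ Δp, ∀ y ∈ hwt H L (e (-γ)), ∀ n ∈ N, ⁅y, n⁆ ∈ N}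
  let N : Submodule ℂ M := sInf S
  have hvN : v ∈ N := by
    simp only [N, Submodule.mem_sInf]
    intro N' hN'
    exact hN'.1
  have hyN : ∀ γ ∈ Δp, ∀ y ∈ hwt H L (e (-γ)), ∀ n ∈ N, ⁅y, n⁆ ∈ N := by
    intro γ hγ y hy n hn
    simp only [N, Submodule.mem_sInf] at hn ⊢
    intro N' hN'
    exact hN'.2 γ hγ y hy n (hn N' hN')
  have hbv : ∀ b : L, ⁅b, v⁆ ∈ N := by
    intro b
    have hb : b ∈ (⨆ χ : H → ℂ, hwt H L χ) := by rw [hlp_top]; trivial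
    induction hb using Submodule.iSup_induction' with
    | mem ψ b hb =>
      by_cases h0 : ψ = 0
      · subst h0
        rw [hv ⟨b, hlp_zero H hb⟩]
        exact N.smul_mem _ hvN
      by_cases hb0 : hwt H L ψ = ⊥
      · rw [hb0, Submodule.mem_bot] at hb
        simp [hb]
      obtain ⟨μ, hμ, rfl⟩ := hroots2 ψ h0 hb0
      rcases hpm μ hμ with h | h
      · rw [hvp μ h b hb]; exact N.zero_mem
      · exact hyN _ h b (by simpa using hb) v hvN
    | zero => simp
    | add x y _ _ hx hy => rw [add_lie]; exact N.add_mem hx hy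
  let P : Submodule ℂ M :=
    { carrier := {w | w ∈ N ∧ ∀ b : L, ⁅b, w⁆ ∈ N}
      add_mem' := by
        intro x y hx hy
        exact ⟨N.add_mem hx.1 hy.1, fun b => by rw [lie_add]; exact N.add_mem (hx.2 b) (hy.2 b)⟩
      zero_mem' := ⟨N.zero_mem, fun b => by simp⟩
      smul_mem' := by
        intro c x hx
        exact ⟨N.smul_mem c hx.1, fun b => by rw [lie_smul]; exact N.smul_mem c (hx.2 b)⟩ }
  have hPS : P ∈ S := by
    refine ⟨⟨hvN, hbv⟩, ?_⟩
    intro γ hγ y hy u hu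
    refine ⟨hyN γ hγ y hy u hu.1, fun b => ?_⟩
    rw [leibniz_lie]
    exact N.add_mem (hu.2 _) (hyN γ hγ y hy _ (hu.2 b))
  have hNP : N ≤ P := sInf_le hPS
  let N' : LieSubmodule ℂ L M := { N with lie_mem := fun {x m} hm => (hNP hm).2 x }
  have hN' : N' = ⊤ := by
    refine (hMsimple N').resolve_left fun h => hv0 ?_
    have : v ∈ N' := hvN
    rw [h] at this
    simpa using this
  have hNtop : N = ⊤ := by
    rw [eq_top_iff]
    intro m _
    have : m ∈ N' := by rw [hN']; trivial
    exact this
  by_contra! hc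
  let W : Submodule ℂ M := ⨆ ψ : H → ℂ, ⨆ _ : ψ ≠ χ, hwt H M ψ
  let W' : Submodule ℂ M := ⨆ c : AddSubmonoid.closure Δp, hwt H M (e (θ - c))
  have hW' : W' ∈ S := by
    refine ⟨?_, ?_⟩
    · apply Submodule.mem_iSup_of_mem (0 : AddSubmonoid.closure Δp)
      simpa using hv
    · intro γ hγ y hy n hn
      induction hn using Submodule.iSup_induction' with
      | mem c n hn =>
        apply Submodule.mem_iSup_of_mem (c + ⟨γ, AddSubmonoid.subset_closure hγ⟩)
        have := hlp_lie H M hy hn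
        rw [← map_add] at this
        convert this using 3
        simp only [AddSubmonoid.coe_add]
        abel
      | zero => simp
      | add x z _ _ hx hz => rw [lie_add]; exact W'.add_mem hx hz
  have hWW : W' ≤ W := by
    refine iSup_le fun c => ?_
    exact le_iSup₂_of_le (f := fun (ψ : H → ℂ) (_ : ψ ≠ χ) => hwt H M ψ)
      (e (θ - c)) (hc c c.2).symm le_rfl
  have hWtop : W = ⊤ := top_le_iff.1 (hNtop ▸ (sInf_le hW').trans hWW)
  have hd : Disjoint (hwt H M χ) W := hlp_ind H M χ
  rw [hWtop, disjoint_top] at hd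
  exact hχ hd

lemma hlp_pair {E : Type} [NormedAddCommGroup E] [InnerProductSpace ℝ E] [FiniteDimensional ℝ E]
    (e : E →+ (H → ℂ)) (heinj : Function.Injective e) (Δ : Set E)
    (hfin : Δ.Finite) (h0 : (0 : E) ∉ Δ)
    (hrefl : ∀ α ∈ Δ, ∀ β ∈ Δ, rrefl α β ∈ Δ)
    (hcrys : ∀ α ∈ Δ, ∀ β ∈ Δ, ∃ n : ℤ, 2 * ⟪β, α⟫ / ⟪α, α⟫ = (n : ℝ))
    (hroots1 : ∀ μ ∈ Δ, hwt H L (e μ) ≠ ⊥)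
    (hroots2 : ∀ χ : H → ℂ, χ ≠ 0 → hwt H L χ ≠ ⊥ → ∃ μ ∈ Δ, χ = e μ)
    (α : E) (hα : α ∈ Δ) {h : H} {x y : L}
    (t : IsSl2Triple (h : L) x y) (hx : x ∈ hwt H L (e α)) (hy : y ∈ hwt H L (-(e α)))
    (β : E) (hβ : β ∈ Δ) :
    e β h = ((2 * ⟪β, α⟫ / ⟪α, α⟫ : ℝ) : ℂ) := by
  have hα0 : α ≠ 0 := fun h => h0 (h ▸ hα)
  have haa : ⟪α, α⟫ ≠ 0 := by simpa using hα0
  have ha : e α h = 2 := by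
    have h1 := hx h
    rw [t.lie_h_e_smul ℂ] at h1
    exact (smul_left_injective ℂ t.e_ne_zero h1).symm
  have hr : ∀ b : E, rrefl α b = b - (2 * ⟪b, α⟫ / ⟪α, α⟫) • α := by
    intro b
    rw [rrefl, Submodule.reflection_orthogonal_apply, Submodule.reflection_singleton_apply]
    rw [real_inner_comm, real_inner_self_eq_norm_sq, ← Nat.cast_smul_eq_nsmul ℝ, smul_smul, neg_sub]
    simp only [Nat.cast_ofNat, mul_div_assoc]
    rfl
  have hchar : ∀ b ∈ Δ, ∃ m : ℤ, e b h = m ∧ b - m • α ∈ Δ := by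
    intro b hb
    obtain ⟨m, hm, hm'⟩ := hlp_str' H L t hx hy (e b) (hroots1 b hb)
    refine ⟨m, hm, ?_⟩
    rw [← map_zsmul, ← map_sub] at hm'
    obtain ⟨μ, hμ, hμe⟩ := hroots2 _ (by
      intro h2
      have h3 : b - m • α = 0 := heinj (by rw [h2, map_zero])
      have h4 : b = m • α := sub_eq_zero.1 h3
      have : e b h = m * 2 := by rw [h4, map_zsmul]; simp [ha]
      rw [hm] at this
      have hm0 : m = 0 := by
        have h5 : (m : ℂ) = 0 := by linear_combination -this
        exact_mod_cast h5
      apply h0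
      rw [hm0, zero_smul] at h4
      rwa [← h4]) hm'
    rwa [heinj hμe]
  obtain ⟨m, hm, -⟩ := hchar β hβ
  obtain ⟨k, hk⟩ := hcrys α hα β hβ
  have hk' : 2 * ⟪β, α⟫ = k * ⟪α, α⟫ := by rw [← hk]; field_simp
  have key : ∀ n : ℕ, β + ((n : ℤ) * (k - m)) • α ∈ Δ := by
    intro n
    induction n with
    | zero => simpa using hβ
    | succ n ih =>
      have h1 := hrefl α hα _ ih
      rw [hr] at h1
      obtain ⟨p, hp, hp'⟩ := hchar _ h1
      have hc : (2 * ⟪β + ((n : ℤ) * (k - m)) • α, α⟫ / ⟪α, α⟫) =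
          ((k + 2 * ((n : ℤ) * (k - m)) : ℤ) : ℝ) := by
        rw [div_eq_iff haa, inner_add_left, ← Int.cast_smul_eq_zsmul ℝ, inner_smul_left]
        push_cast
        simp only [conj_trivial]
        linear_combination hk'
      rw [hc, Int.cast_smul_eq_zsmul ℝ] at hp hp'
      rw [map_sub, map_add, map_zsmul, map_zsmul] at hp
      simp only [Pi.sub_apply, Pi.add_apply, Pi.smul_apply, ha, hm] at hp
      simp only [zsmul_eq_mul] at hp
      have hp2 : p = m + (n * (k - m)) * 2 - (k + 2 * (n * (k - m))) * 2 := by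
        exact_mod_cast hp.symm
      convert hp' using 1
      rw [hp2]
      push_cast
      module
  have hkm : k = m := by
    by_contra hne
    refine Set.infinite_of_injective_forall_mem (f := fun n : ℕ => β + ((n : ℤ) * (k - m)) • α)
      ?_ key hfin
    intro n n' hnn
    have h1 := add_left_cancel hnn
    simp only [← Int.cast_smul_eq_zsmul ℝ] at h1
    have h2 := Int.cast_injective (smul_left_injective ℝ hα0 h1)
    have h3 := mul_right_cancel₀ (sub_ne_zero.2 hne) h2
    exact_mod_cast h3
  rw [hm, hk, hkm]
  simp

end helpers

/-- Let `𝔥 = 𝔱 ⊕ (⊕_{μ∈Δl} 𝔤^μ)` be spanned by the Cartan subalgebra and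
all long root spaces.  Then the zero weight space of the little adjoint module is exactly
the set of vectors annihilated by `𝔥`. -/
theorem statement10
    {E : Type} [NormedAddCommGroup E] [InnerProductSpace ℝ E] [FiniteDimensional ℝ E]
    (Δ Δs Δl Δp Φ Φs : Set E)
    -- `Δ` is a reduced crystallographic root system in `E`
    (hfin : Δ.Finite) (h0 : (0 : E) ∉ Δ)
    (hspan : Submodule.span ℝ Δ = ⊤)
    (hrefl : ∀ α ∈ Δ, ∀ β ∈ Δ, rrefl α β ∈ Δ)
    (hcrys : ∀ α ∈ Δ, ∀ β ∈ Δ, ∃ n : ℤ, 2 * ⟪β, α⟫ / ⟪α, α⟫ = (n : ℝ))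
    (hred : ∀ α ∈ Δ, ∀ t : ℝ, t • α ∈ Δ → t = 1 ∨ t = -1)
    -- irreducible
    (hirr : ∀ A B : Set E, A ∪ B = Δ → (∀ a ∈ A, ∀ b ∈ B, ⟪a, b⟫ = 0) → A = ∅ ∨ B = ∅)
    -- two root lengths: `Δs` are the short roots, `Δl` the long ones
    (ls ll : ℝ) (h0ls : 0 < ls) (hlsll : ls < ll)
    (hΔs : Δs = {α ∈ Δ | ‖α‖ = ls}) (hΔl : Δl = {α ∈ Δ | ‖α‖ = ll})
    (hcover : Δ = Δs ∪ Δl) (hsne : Δs.Nonempty) (hlne : Δl.Nonempty)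
    -- `Δp` is a positive system with simple roots `Φ`; `Φs = Φ ∩ Δs`
    (hΔpΔ : Δp ⊆ Δ) (hpm : ∀ α ∈ Δ, α ∈ Δp ↔ -α ∉ Δp)
    (hΦp : Φ ⊆ Δp)
    (hΦind : LinearIndependent ℝ (fun a : Φ => (a : E)))
    (hΦdec : ∀ γ ∈ Δp, ∃ c : E →₀ ℕ, ↑c.support ⊆ Φ ∧ γ = c.sum fun α n => (n : ℝ) • α)
    (hΦs : Φs = Φ ∩ Δs)
    -- `θs` is the highest short root
    (θs : E) (hθsmem : θs ∈ Δs ∩ Δp)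
    (hθshigh : ∀ γ ∈ Δs, ∃ c : E →₀ ℝ, ↑c.support ⊆ Φ ∧ (∀ α, 0 ≤ c α) ∧
      θs - γ = c.sum fun α t => t • α)
    -- `L` is a complex simple Lie algebra with Cartan subalgebra `H`, whose root system
    -- is identified with `Δ` via `e`
    (L : Type) [LieRing L] [LieAlgebra ℂ L] [FiniteDimensional ℂ L]
    [LieAlgebra.IsSimple ℂ L]
    (H : LieSubalgebra ℂ L) [H.IsCartanSubalgebra]
    (e : E → H → ℂ)
    (headd : ∀ a b : E, e (a + b) = e a + e b)
    (heinj : Function.Injective e)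
    (hroots1 : ∀ μ ∈ Δ, hwt H L (e μ) ≠ ⊥)
    (hroots2 : ∀ χ : H → ℂ, χ ≠ 0 → hwt H L χ ≠ ⊥ → ∃ μ ∈ Δ, χ = e μ)
    -- `M` is the little adjoint module `V_{θs}`: the (finite-dimensional) simple
    -- `L`-module with highest weight `θs`
    (M : Type) [AddCommGroup M] [Module ℂ M] [LieRingModule L M] [LieModule ℂ L M]
    [FiniteDimensional ℂ M] [Nontrivial M]
    (hMsimple : ∀ N : LieSubmodule ℂ L M, N = ⊥ ∨ N = ⊤)
    (hhw : ∃ v : M, v ≠ 0 ∧ v ∈ hwt H M (e θs) ∧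
      ∀ γ ∈ Δp, ∀ x ∈ hwt H L (e γ), ⁅x, v⁆ = 0)
 :
    (hwt H M (0 : H → ℂ) : Set M) =
      {v : M | (∀ x : H, ⁅(x : L), v⁆ = 0) ∧
        ∀ μ ∈ Δl, ∀ y ∈ hwt H L (e μ), ⁅y, v⁆ = 0} := by
  have hK : LieAlgebra.IsKilling ℂ L := inferInstance
  obtain ⟨v, hv0, hv, hvp⟩ := hhw
  let e' : E →+ (H → ℂ) := AddMonoidHom.mk' e headd
  have heinj' : Function.Injective e' := heinj
  have hpm' : ∀ μ ∈ Δ, μ ∈ Δp ∨ -μ ∈ Δp := by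
    intro μ hμ
    by_cases h : -μ ∈ Δp
    · exact Or.inr h
    · exact Or.inl ((hpm μ hμ).2 h)
  have hwts := hlp_hw H M e' Δ Δp θs hroots2 hpm' hMsimple v hv0 hv hvp
  obtain ⟨f, hf⟩ : ∃ f : E →ₗ[ℝ] ℝ, ∀ γ ∈ Δp, 0 < f γ := by
    let b := Module.Basis.span hΦind
    obtain ⟨f, hf⟩ := LinearMap.exists_extend (b.constr ℝ (fun _ => (1 : ℝ)))
    have hf1 : ∀ a ∈ Φ, f a = 1 := by
      intro a ha
      have h1 := b.constr_basis ℝ (fun _ => (1 : ℝ)) ⟨a, ha⟩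
      rw [← hf] at h1
      simpa [b, Module.Basis.span_apply] using h1
    refine ⟨f, fun γ hγ => ?_⟩
    obtain ⟨c, hc, hγc⟩ := hΦdec γ hγ
    have hfc : f γ = ∑ a ∈ c.support, (c a : ℝ) := by
      rw [hγc, Finsupp.sum, map_sum]
      refine Finset.sum_congr rfl fun a ha => ?_
      rw [map_smul, hf1 a (hc ha), smul_eq_mul, mul_one]
    rw [hfc]
    apply Finset.sum_pos
    · intro a ha
      exact_mod_cast Nat.pos_of_ne_zero (Finsupp.mem_support_iff.1 ha)
    · rw [Finset.nonempty_iff_ne_empty]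
      intro hce
      rw [Finsupp.support_eq_empty] at hce
      apply h0
      have : γ = 0 := by rw [hγc, hce]; simp
      rw [← this]
      exact hΔpΔ hγ
  have hmain : ∀ μ ∈ Δl, hwt H M (e μ) = ⊥ := by
    intro μ hμ
    by_contra hne
    have hTfin : {l : E | hwt H M (e l) ≠ ⊥ ∧ ‖l‖ = ll}.Finite :=
      ((hlp_fin H M).preimage heinj.injOn).subset (fun l hl => hl.1)
    have hμl : ‖μ‖ = ll := by rw [hΔl] at hμ; exact hμ.2
    obtain ⟨l, ⟨hl1, hl2⟩, hlmax⟩ := Set.exists_max_image _ f hTfin ⟨μ, hne, hμl⟩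
    obtain ⟨c, hc, hlc'⟩ := hwts _ hl1
    have hlc : l = θs - c := heinj hlc'
    have hsub : ∀ d ∈ AddSubmonoid.closure Δp, d ∈ AddSubgroup.closure Δ := by
      intro d hd
      have : AddSubmonoid.closure Δp ≤ (AddSubgroup.closure Δ).toAddSubmonoid :=
        (AddSubmonoid.closure_le).2 fun a ha => AddSubgroup.subset_closure (hΔpΔ ha)
      exact this hd
    have hθΔ : θs ∈ Δ := hΔpΔ hθsmem.2
    have hθn : ‖θs‖ = ls := by
      have := hθsmem.1
      rw [hΔs] at this
      exact this.2
    have hlat : l ∈ AddSubgroup.closure Δ := by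
      rw [hlc]
      exact sub_mem (AddSubgroup.subset_closure hθΔ) (hsub c hc)
    have hdom : ∀ γ ∈ Δp, 0 ≤ ⟪l, γ⟫ := by
      intro γ hγ
      by_contra! hneg
      have hγΔ := hΔpΔ hγ
      have hγ0 : γ ≠ 0 := fun h => h0 (h ▸ hγΔ)
      have heγ0 : e γ ≠ 0 := fun h => hγ0 (heinj' (by rw [map_zero]; exact h))
      have hgg : 0 < ⟪γ, γ⟫ := real_inner_self_pos.2 hγ0
      obtain ⟨h, x, y, t, hx, hy⟩ := hlp_sl2 H (e γ) heγ0 (hroots1 γ hγΔ)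
      have hpair : ∀ b ∈ AddSubgroup.closure Δ,
          e' b h = ((2 * ⟪b, γ⟫ / ⟪γ, γ⟫ : ℝ) : ℂ) := by
        intro b hb
        induction hb using AddSubgroup.closure_induction with
        | mem b hb =>
          exact hlp_pair H e' heinj' Δ hfin h0 hrefl hcrys hroots1 hroots2 γ hγΔ t hx hy b hb
        | zero => simp
        | add b c _ _ hb hc =>
          rw [map_add, Pi.add_apply, hb, hc, inner_add_left]
          push_cast
          ring
        | neg b _ hb =>
          rw [map_neg, Pi.neg_apply, hb, inner_neg_left]
          push_cast
          ring
      obtain ⟨k, hk, hk'⟩ := hlp_str' H M t hx hy (e l) hl1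
      have hkr : (2 * ⟪l, γ⟫ / ⟪γ, γ⟫ : ℝ) = k := by
        have := (hpair l hlat).symm.trans hk
        exact_mod_cast this
      have hk2 : 2 * ⟪l, γ⟫ = k * ⟪γ, γ⟫ := by rw [← hkr]; field_simp
      have hkneg : (k : ℝ) < 0 := by
        rw [← hkr]
        exact div_neg_of_neg_of_pos (by linarith) hgg
      have hee : e l - k • e γ = e (l - (k : ℝ) • γ) := by
        change e' l - k • e' γ = e' _
        rw [Int.cast_smul_eq_zsmul ℝ, map_sub, map_zsmul]
      rw [hee] at hk'
      have hnorm : ‖l - (k : ℝ) • γ‖ = ll := by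
        rw [← hl2, ← sq_eq_sq₀ (norm_nonneg _) (norm_nonneg _), norm_sub_sq_real,
          inner_smul_right, norm_smul, mul_pow, ← real_inner_self_eq_norm_sq γ,
          Real.norm_eq_abs, sq_abs]
        linear_combination -(k : ℝ) * hk2
      have := hlmax _ ⟨hk', hnorm⟩
      rw [map_sub, map_smul, smul_eq_mul] at this
      have := mul_neg_of_neg_of_pos hkneg (hf γ hγ)
      linarith
    have hcl : 0 ≤ ⟪l, c⟫ := by
      clear hlc hlc'
      induction hc using AddSubmonoid.closure_induction with
      | mem b hb => exact hdom b hb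
      | zero => simp
      | add a b _ _ ha hb => rw [inner_add_right]; exact add_nonneg ha hb
    have h1 : ⟪l, θs⟫ ≤ ‖l‖ * ‖θs‖ := real_inner_le_norm l θs
    have h2 : ⟪l, l⟫ = ⟪l, θs⟫ - ⟪l, c⟫ := by
      conv_lhs => rw [hlc]
      rw [← hlc, ← inner_sub_right, ← hlc]
    rw [real_inner_self_eq_norm_sq, hl2] at h2
    rw [hl2, hθn] at h1
    nlinarith
  ext w
  constructor
  · intro hw
    have hw' : w ∈ hwt H M (0 : H → ℂ) := hw
    refine ⟨fun x => by simpa using hw' x, fun μ hμ y hy => ?_⟩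
    have := hlp_lie H M hy hw'
    rwa [zero_add, hmain μ hμ, Submodule.mem_bot] at this
  · rintro ⟨hw, -⟩
    change w ∈ hwt H M (0 : H → ℂ)
    intro x
    rw [hw x]
    simp
end

section
/- For every short root μ ∈ Δ_s and every nonzero root vector e_μ ∈ 𝔤^μ, the linear map ẽ_μ : V_{θ_s}^0 → V_{θ_s}^μ, v ↦ e_μ·v, is nonzero; since the weight space V_{θ_s}^μ is one-dimensional, its kernel H_μ = Ker ẽ_μ is a hyperplane in V_{θ_s}^0. -/
open scoped RealInnerProductSpace

lemma lie_mem_hwt {L : Type} [LieRing L] [LieAlgebra ℂ L] (H : LieSubalgebra ℂ L)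
    (M : Type) [AddCommGroup M] [Module ℂ M] [LieRingModule L M] [LieModule ℂ L M]
    {χ ψ : H → ℂ} {x : L} {v : M} (hx : x ∈ hwt H L χ) (hv : v ∈ hwt H M ψ) :
    ⁅x, v⁆ ∈ hwt H M (χ + ψ) := by
  intro h
  have h1 : ⁅(h : L), x⁆ = χ h • x := hx h
  have h2 : ⁅(h : L), v⁆ = ψ h • v := hv h
  rw [leibniz_lie, h1, h2, smul_lie, lie_smul, Pi.add_apply, add_smul]

open LieAlgebra LieModule LieAlgebra.IsKilling in
lemma exists_opp {L : Type} [LieRing L] [LieAlgebra ℂ L] [FiniteDimensional ℂ L]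
    [LieAlgebra.IsSimple ℂ L] (H : LieSubalgebra ℂ L) [H.IsCartanSubalgebra]
    (χ : H → ℂ) (hχ : χ ≠ 0) (x : L) (hx : x ∈ hwt H L χ) (hx0 : x ≠ 0) :
    ∃ y ∈ hwt H L (-χ), ∃ h : H, ⁅x, y⁆ = (h : L) ∧ χ h ≠ 0 := by
  have hxr : x ∈ rootSpace H χ := by
    apply weightSpace_le_genWeightSpace L χ
    rw [mem_weightSpace]
    intro h
    exact hx h
  let α : Weight ℂ H L := ⟨χ, fun hb => hx0 (by
    have := hxr
    rw [rootSpace, hb] at this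
    simpa using this)⟩
  have hα : α.IsNonZero := fun h => hχ h
  have hxr' : x ∈ rootSpace H α := hxr
  obtain ⟨f, hfα, hf⟩ : ∃ f ∈ rootSpace H (-α), killingForm ℂ L x f ≠ 0 := by
    by_contra! hc
    apply hx0
    simpa using mem_ker_killingForm_of_mem_rootSpace_of_forall_rootSpace_neg ℂ L H hxr' hc
  have hef := lie_eq_killingForm_smul_of_mem_rootSpace_of_mem_rootSpace_neg hxr' hfα
  refine ⟨f, fun h => lie_eq_smul_of_mem_rootSpace hfα h,
    killingForm ℂ L x f • (cartanEquivDual H).symm α, ?_, ?_⟩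
  · rw [hef]; rfl
  · change α _ ≠ 0
    rw [map_smul, smul_eq_mul, ne_eq, mul_eq_zero, not_or]
    exact ⟨hf, root_apply_cartanEquivDual_symm_ne_zero hα⟩

/-- For every short root `μ` and every nonzero root vector `x ∈ 𝔤^μ`, the
map `V⁰ → V^μ`, `v ↦ x·v`, is nonzero; since `V^μ` is one-dimensional its kernel `H_μ` is a
hyperplane in `V⁰`. -/
theorem statement11
    {E : Type} [NormedAddCommGroup E] [InnerProductSpace ℝ E] [FiniteDimensional ℝ E]
    (Δ Δs Δl Δp Φ Φs : Set E)
    -- `Δ` is a reduced crystallographic root system in `E`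
    (hfin : Δ.Finite) (h0 : (0 : E) ∉ Δ)
    (hspan : Submodule.span ℝ Δ = ⊤)
    (hrefl : ∀ α ∈ Δ, ∀ β ∈ Δ, rrefl α β ∈ Δ)
    (hcrys : ∀ α ∈ Δ, ∀ β ∈ Δ, ∃ n : ℤ, 2 * ⟪β, α⟫ / ⟪α, α⟫ = (n : ℝ))
    (hred : ∀ α ∈ Δ, ∀ t : ℝ, t • α ∈ Δ → t = 1 ∨ t = -1)
    -- irreducible
    (hirr : ∀ A B : Set E, A ∪ B = Δ → (∀ a ∈ A, ∀ b ∈ B, ⟪a, b⟫ = 0) → A = ∅ ∨ B = ∅)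
    -- two root lengths: `Δs` are the short roots, `Δl` the long ones
    (ls ll : ℝ) (h0ls : 0 < ls) (hlsll : ls < ll)
    (hΔs : Δs = {α ∈ Δ | ‖α‖ = ls}) (hΔl : Δl = {α ∈ Δ | ‖α‖ = ll})
    (hcover : Δ = Δs ∪ Δl) (hsne : Δs.Nonempty) (hlne : Δl.Nonempty)
    -- `Δp` is a positive system with simple roots `Φ`; `Φs = Φ ∩ Δs`
    (hΔpΔ : Δp ⊆ Δ) (hpm : ∀ α ∈ Δ, α ∈ Δp ↔ -α ∉ Δp)
    (hΦp : Φ ⊆ Δp)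
    (hΦind : LinearIndependent ℝ (fun a : Φ => (a : E)))
    (hΦdec : ∀ γ ∈ Δp, ∃ c : E →₀ ℕ, ↑c.support ⊆ Φ ∧ γ = c.sum fun α n => (n : ℝ) • α)
    (hΦs : Φs = Φ ∩ Δs)
    -- `θs` is the highest short root
    (θs : E) (hθsmem : θs ∈ Δs ∩ Δp)
    (hθshigh : ∀ γ ∈ Δs, ∃ c : E →₀ ℝ, ↑c.support ⊆ Φ ∧ (∀ α, 0 ≤ c α) ∧
      θs - γ = c.sum fun α t => t • α)
    -- `L` is a complex simple Lie algebra with Cartan subalgebra `H`, whose root system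
    -- is identified with `Δ` via `e`
    (L : Type) [LieRing L] [LieAlgebra ℂ L] [FiniteDimensional ℂ L]
    [LieAlgebra.IsSimple ℂ L]
    (H : LieSubalgebra ℂ L) [H.IsCartanSubalgebra]
    (e : E → H → ℂ)
    (headd : ∀ a b : E, e (a + b) = e a + e b)
    (heinj : Function.Injective e)
    (hroots1 : ∀ μ ∈ Δ, hwt H L (e μ) ≠ ⊥)
    (hroots2 : ∀ χ : H → ℂ, χ ≠ 0 → hwt H L χ ≠ ⊥ → ∃ μ ∈ Δ, χ = e μ)
    -- `M` is the little adjoint module `V_{θs}`: the (finite-dimensional) simple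
    -- `L`-module with highest weight `θs`
    (M : Type) [AddCommGroup M] [Module ℂ M] [LieRingModule L M] [LieModule ℂ L M]
    [FiniteDimensional ℂ M] [Nontrivial M]
    (hMsimple : ∀ N : LieSubmodule ℂ L M, N = ⊥ ∨ N = ⊤)
    (hhw : ∃ v : M, v ≠ 0 ∧ v ∈ hwt H M (e θs) ∧
      ∀ γ ∈ Δp, ∀ x ∈ hwt H L (e γ), ⁅x, v⁆ = 0)
    -- the weights of `M` are `Δs ∪ {0}`, and each nonzero weight has multiplicity one
    (hwts : ∀ χ : H → ℂ, hwt H M χ ≠ ⊥ → χ = 0 ∨ ∃ μ ∈ Δs, χ = e μ)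
    (hmult1 : ∀ μ ∈ Δs, Module.finrank ℂ ↥(hwt H M (e μ)) = 1)
 :
    ∀ μ ∈ Δs, ∀ x ∈ hwt H L (e μ), x ≠ 0 →
      (∃ v ∈ hwt H M (0 : H → ℂ), ⁅x, v⁆ ≠ 0) ∧
      Module.finrank ℂ ↥(hwt H M (0 : H → ℂ) ⊓ LinearMap.ker (adm L M x)) + 1 =
        Module.finrank ℂ ↥(hwt H M (0 : H → ℂ)) := by
  intro μ hμ x hx hx0
  have he0 : e 0 = 0 := by
    have := headd 0 0
    rw [add_zero] at this
    exact left_eq_add.mp this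
  have hμΔ : μ ∈ Δ := by rw [hcover]; exact Or.inl hμ
  have hμ0 : μ ≠ 0 := fun h => h0 (h ▸ hμΔ)
  have heμ : e μ ≠ 0 := fun h => hμ0 (heinj (h.trans he0.symm))
  obtain ⟨y, hy, h, hxy, hh⟩ := exists_opp H (e μ) heμ x hx hx0
  have hdbl : hwt H M (e μ + e μ) = ⊥ := by
    by_contra hne
    rw [← headd] at hne
    have h2 : μ + μ = (2 : ℝ) • μ := (two_smul ℝ μ).symm
    rcases hwts _ hne with hz | ⟨ν, hν, hz⟩
    · have := heinj (hz.trans he0.symm)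
      rw [h2] at this
      simp [hμ0] at this
    · have := heinj hz
      rw [h2] at this
      have hνΔ : ν ∈ Δ := by rw [hcover]; exact Or.inl hν
      rw [← this] at hνΔ
      rcases hred μ hμΔ 2 hνΔ with h | h <;> norm_num at h
  -- every `w` of weight `μ` is hit
  have hsurj : ∀ w ∈ hwt H M (e μ), ∃ v ∈ hwt H M (0 : H → ℂ), ⁅x, v⁆ = w := by
    intro w hw
    have hxw : ⁅x, w⁆ = 0 := by
      have := lie_mem_hwt H M hx hw
      rw [hdbl] at this
      simpa using this
    have hyw : ⁅y, w⁆ ∈ hwt H M (0 : H → ℂ) := by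
      have := lie_mem_hwt H M hy hw
      rwa [neg_add_cancel] at this
    refine ⟨(e μ h)⁻¹ • ⁅y, w⁆, Submodule.smul_mem _ _ hyw, ?_⟩
    have hhw' : ⁅(h : L), w⁆ = e μ h • w := hw h
    rw [lie_smul, leibniz_lie, hxw, lie_zero, add_zero, hxy, hhw', smul_smul,
      inv_mul_cancel₀ hh, one_smul]
  have hmap : (hwt H M (0 : H → ℂ)).map (adm L M x) = hwt H M (e μ) := by
    apply le_antisymm
    · rintro _ ⟨v, hv, rfl⟩
      have := lie_mem_hwt H M hx hv
      rwa [add_zero] at this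
    · intro w hw
      obtain ⟨v, hv, hvw⟩ := hsurj w hw
      exact ⟨v, hv, hvw⟩
  refine ⟨?_, ?_⟩
  · have hne : hwt H M (e μ) ≠ ⊥ := by
      intro hb
      have := hmult1 μ hμ
      rw [hb, finrank_bot] at this
      exact zero_ne_one this
    obtain ⟨w, hw, hw0⟩ := Submodule.exists_mem_ne_zero_of_ne_bot hne
    obtain ⟨v, hv, hvw⟩ := hsurj w hw
    exact ⟨v, hv, hvw ▸ hw0⟩
  · set V := hwt H M (0 : H → ℂ)
    have hrn := LinearMap.finrank_range_add_finrank_ker ((adm L M x).domRestrict V)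
    have hr : LinearMap.range ((adm L M x).domRestrict V) = hwt H M (e μ) := by
      rw [← hmap, LinearMap.range_domRestrict]
    have hk : Module.finrank ℂ (LinearMap.ker ((adm L M x).domRestrict V)) =
        Module.finrank ℂ ↥(V ⊓ LinearMap.ker (adm L M x)) := by
      rw [LinearMap.ker_domRestrict, ← Submodule.map_comap_subtype V]
      exact (Submodule.finrank_map_subtype_eq V _).symm
    rw [hr, hmult1 μ hμ, hk] at hrn
    omega
end
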